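/- Suppose that B_∞(x,θ) > 0 for every (x,θ) ∈ 𝕋² × S¹. Let h_n → 0⁺ and let u_n : ℝ² → ℂ be twice continuously differentiable with 𝒯_m^B u_n = u_n for all m ∈ ℤ², ‖u_n‖_{L²} = 1, and ‖h_n² 𝓛_α u_n − u_n‖_{L²} = o(h_n^{3/2}) as n → ∞. Then for every continuous ℤ²-periodic a : ℝ² → ℂ, ∫_{[0,1]²} a(x)|u_n(x)|² dx → ∫_{[0,1]²} a(x) dx; in other words, the only quantum limit for 𝓛_α is the Lebesgue measure on 𝕋². -/

import Mathlib

open MeasureTheory Filter Topology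
open scoped Real ENNReal

noncomputable section

abbrev Pt : Type := ℝ × ℝ

/-- `v ∧ w = v₁w₂ - v₂w₁`. -/
def wedge (v w : Pt) : ℝ := v.1 * w.2 - v.2 * w.1

/-- Euclidean dot product on `ℝ²`. -/
def dotp (v w : Pt) : ℝ := v.1 * w.1 + v.2 * w.2

/-- The fundamental domain `[0,1]²` of the torus `𝕋² = ℝ²/ℤ²`. -/
def fund : Set Pt := Set.Icc (0, 0) (1, 1)

/-- `ℤ²`-periodicity of a function on `ℝ²`. -/
def IsPeriodic {E : Type*} (f : Pt → E) : Prop :=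
  ∀ (m : ℤ × ℤ) (x : Pt), f (x.1 + m.1, x.2 + m.2) = f x

/-- The magnetic translation `𝒯_m^B` associated to the flux `B0 = B̂₀`. -/
def magTrans (B0 : ℝ) (m : ℤ × ℤ) (u : Pt → ℂ) : Pt → ℂ := fun x =>
  Complex.exp (Complex.I * (B0 / 2) * (wedge ((m.1 : ℝ), (m.2 : ℝ)) x : ℝ)) *
    u (x.1 - m.1, x.2 - m.2)

/-- First partial derivative of a complex valued function on `ℝ²`. -/
def pd1 (u : Pt → ℂ) : Pt → ℂ := fun x => fderiv ℝ u x (1, 0)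

/-- Second partial derivative of a complex valued function on `ℝ²`. -/
def pd2 (u : Pt → ℂ) : Pt → ℂ := fun x => fderiv ℝ u x (0, 1)

/-- First partial derivative of a real valued function on `ℝ²`. -/
def pdR1 (f : Pt → ℝ) : Pt → ℝ := fun x => fderiv ℝ f x (1, 0)

/-- Second partial derivative of a real valued function on `ℝ²`. -/
def pdR2 (f : Pt → ℝ) : Pt → ℝ := fun x => fderiv ℝ f x (0, 1)

/-- The vector potential `A⁰(x₁,x₂) = (B̂₀/2)(−x₂, x₁)`. -/
def A0 (B0 : ℝ) : Pt → Pt := fun x => (B0 / 2 * (-x.2), B0 / 2 * x.1)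

/-- `(-i∂₁ - α₁ - A₁) u`. -/
def Dop1 (α : Pt) (A : Pt → Pt) (u : Pt → ℂ) : Pt → ℂ := fun x =>
  -Complex.I * pd1 u x - ((α.1 + (A x).1 : ℝ) : ℂ) * u x

/-- `(-i∂₂ - α₂ - A₂) u`. -/
def Dop2 (α : Pt) (A : Pt → Pt) (u : Pt → ℂ) : Pt → ℂ := fun x =>
  -Complex.I * pd2 u x - ((α.2 + (A x).2 : ℝ) : ℂ) * u x

/-- The magnetic Laplacian `𝓛_α u = (−i∂₁−α₁−A₁)²u + (−i∂₂−α₂−A₂)²u`. -/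
def magLap (α : Pt) (A : Pt → Pt) (u : Pt → ℂ) : Pt → ℂ := fun x =>
  Dop1 α A (Dop1 α A u) x + Dop2 α A (Dop2 α A u) x

/-- Membership in `C^∞(𝕋²,L)`: smooth and invariant under all magnetic translations. -/
def MemCL (B0 : ℝ) (u : Pt → ℂ) : Prop :=
  ContDiff ℝ (⊤ : ℕ∞) u ∧ ∀ m : ℤ × ℤ, magTrans B0 m u = u

end

open scoped ComplexConjugate

noncomputable section

section ParametricIntegral

variable {E : Type} [NormedAddCommGroup E] [NormedSpace ℝ E]

theorem hasFDerivAt_parametric_intervalIntegral [CompleteSpace E] {F : Pt → ℝ → E}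
    (hF : ContDiff ℝ 1 (Function.uncurry F)) (a b : ℝ) (x₀ : Pt) :
    HasFDerivAt (fun x => ∫ t in a..b, F x t)
      (∫ t in a..b, (fderiv ℝ (Function.uncurry F) (x₀, t)).comp
        (ContinuousLinearMap.inl ℝ Pt ℝ)) x₀ := by
  have hc : Continuous fun p : Pt × ℝ =>
      (fderiv ℝ (Function.uncurry F) p).comp (ContinuousLinearMap.inl ℝ Pt ℝ) :=
    (hF.continuous_fderiv one_ne_zero).clm_comp continuous_const
  have hcs : ∀ x, Continuous (F x) := fun x =>
    hF.continuous.comp (continuous_const.prodMk continuous_id)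
  obtain ⟨C, hC⟩ := ((isCompact_closedBall x₀ 1).prod (isCompact_uIcc (a := a) (b := b))
    ).exists_bound_of_continuousOn hc.continuousOn
  refine intervalIntegral.hasFDerivAt_integral_of_dominated_of_fderiv_le
    (F' := fun x t => (fderiv ℝ (Function.uncurry F) (x, t)).comp
        (ContinuousLinearMap.inl ℝ Pt ℝ)) (bound := fun _ => C) (s := Metric.closedBall x₀ 1)
    (Metric.closedBall_mem_nhds x₀ one_pos) (Eventually.of_forall fun x =>
      (hcs x).aestronglyMeasurable) ((hcs x₀).intervalIntegrable _ _)
    (hc.comp (continuous_const.prodMk continuous_id)).aestronglyMeasurable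
    (Eventually.of_forall fun t ht x hx => hC (x, t) ⟨hx, Set.uIoc_subset_uIcc ht⟩)
    intervalIntegrable_const (Eventually.of_forall fun t _ x _ => ?_)
  have h1 : HasFDerivAt (Function.uncurry F) (fderiv ℝ (Function.uncurry F) (x, t)) (x, t) :=
    (hF.differentiable one_ne_zero (x, t)).hasFDerivAt
  have h2 : HasFDerivAt (fun y : Pt => (y, t)) (ContinuousLinearMap.inl ℝ Pt ℝ) x := by
    simpa using hasFDerivAt_prodMk_left x t
  exact h1.comp x h2

end ParametricIntegral

theorem contDiff_parametric_intervalIntegral (n : ℕ) {E : Type} [NormedAddCommGroup E]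
    [NormedSpace ℝ E] [CompleteSpace E] {F : Pt → ℝ → E}
    (hF : ContDiff ℝ n (Function.uncurry F)) (a b : ℝ) :
    ContDiff ℝ n fun x => ∫ t in a..b, F x t := by
  induction n generalizing E with
  | zero =>
    rw [Nat.cast_zero, contDiff_zero] at hF ⊢
    exact intervalIntegral.continuous_parametric_intervalIntegral_of_continuous' hF a b
  | succ n ih =>
    push_cast at hF ⊢
    rw [contDiff_succ_iff_hasFDerivAt]
    refine ⟨fun x => ∫ t in a..b, (fderiv ℝ (Function.uncurry F) (x, t)).comp
        (ContinuousLinearMap.inl ℝ Pt ℝ), ih ?_, fun x =>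
      hasFDerivAt_parametric_intervalIntegral (hF.of_le (by simp)) a b x⟩
    exact (hF.fderiv_right le_rfl).clm_comp contDiff_const

section PeriodicIntegral

theorem fund_eq_prod : fund = Set.Icc (0 : ℝ) 1 ×ˢ Set.Icc (0 : ℝ) 1 := by
  rw [Set.Icc_prod_Icc]; rfl

theorem isCompact_fund : IsCompact fund := isCompact_Icc

theorem volume_real_fund : (volume : Measure Pt).real fund = 1 := by
  rw [fund_eq_prod, Measure.real, Measure.volume_eq_prod, Measure.prod_prod]
  simp

theorem integrable_fund {E : Type*} [NormedAddCommGroup E] {f : Pt → E} (hf : Continuous f) :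
    Integrable f (volume.restrict fund) :=
  hf.continuousOn.integrableOn_compact isCompact_fund

theorem integral_fund_eq {f : Pt → ℂ} (hf : Continuous f) :
    ∫ x in fund, f x = ∫ s in (0 : ℝ)..1, ∫ t in (0 : ℝ)..1, f (s, t) := by
  have h := integrable_fund hf
  rw [fund_eq_prod, Measure.volume_eq_prod] at h ⊢
  rw [setIntegral_prod f h, intervalIntegral.integral_of_le zero_le_one,
    integral_Icc_eq_integral_Ioc]
  simp_rw [intervalIntegral.integral_of_le zero_le_one, integral_Icc_eq_integral_Ioc]

theorem integral_fund_translate {f : Pt → ℂ} (hf : Continuous f) (hp : IsPeriodic f) (v : Pt) :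
    ∫ x in fund, f (x + v) = ∫ x in fund, f x := by
  rw [integral_fund_eq hf, integral_fund_eq (by fun_prop)]
  have h2 : ∀ s : ℝ, ∫ t in (0 : ℝ)..1, f ((s, t) + v) = ∫ t in (0 : ℝ)..1, f (s + v.1, t) := by
    intro s
    have hper : Function.Periodic (fun t => f (s + v.1, t)) 1 := fun t => by
      simpa using hp (0, 1) (s + v.1, t)
    have := hper.intervalIntegral_add_eq v.2 0
    rw [zero_add] at this
    have h3 := intervalIntegral.integral_comp_add_right (a := 0) (b := 1)
      (fun t => f (s + v.1, t)) v.2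
    rw [zero_add, add_comm 1] at h3
    rw [← this, ← h3]
    rfl
  simp_rw [h2]
  have hper : Function.Periodic (fun s => ∫ t in (0 : ℝ)..1, f (s, t)) 1 := fun s => by
    refine intervalIntegral.integral_congr fun t _ => ?_
    simpa using hp (1, 0) (s, t)
  have := hper.intervalIntegral_add_eq v.1 0
  rw [zero_add] at this
  have h3 := intervalIntegral.integral_comp_add_right (a := 0) (b := 1)
    (fun s => ∫ t in (0 : ℝ)..1, f (s, t)) v.1
  rw [zero_add, add_comm 1] at h3
  rw [← this, ← h3]

theorem integral_fund_swap {f : ℝ → Pt → ℂ} (hf : Continuous (Function.uncurry f)) (a b : ℝ) :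
    ∫ t in a..b, ∫ x in fund, f t x = ∫ x in fund, ∫ t in a..b, f t x := by
  have key : ∀ a b : ℝ, a ≤ b →
      ∫ t in a..b, ∫ x in fund, f t x = ∫ x in fund, ∫ t in a..b, f t x := by
    intro a b hab
    simp_rw [intervalIntegral.integral_of_le hab, ← integral_Icc_eq_integral_Ioc]
    refine integral_integral_swap ?_
    rw [Measure.prod_restrict, ← Measure.volume_eq_prod]
    exact hf.continuousOn.integrableOn_compact (isCompact_Icc.prod isCompact_fund)
  rcases le_total a b with hab | hab
  · exact key a b hab
  · simp_rw [intervalIntegral.integral_symm b a, integral_neg, key b a hab]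

theorem IsPeriodic.fderiv {f : Pt → ℂ} (hp : IsPeriodic f) (d : Pt) :
    IsPeriodic fun x => fderiv ℝ f x d := by
  intro m x
  have h : (fun y : Pt => f (y + ((m.1 : ℝ), (m.2 : ℝ)))) = f := funext fun y => hp m y
  have h2 := fderiv_comp_add_right (𝕜 := ℝ) (f := f) (x := x) ((m.1 : ℝ), (m.2 : ℝ))
  rw [h] at h2
  simp only [h2]
  rfl

theorem integral_fund_fderiv {f : Pt → ℂ} (hf : ContDiff ℝ 1 f) (hp : IsPeriodic f) (d : Pt) :
    ∫ x in fund, fderiv ℝ f x d = 0 := by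
  have hc : Continuous fun x => fderiv ℝ f x d :=
    (hf.continuous_fderiv one_ne_zero).clm_apply continuous_const
  have h1 := integral_fund_swap (f := fun t x => fderiv ℝ f (x + t • d) d)
    (hc.comp (by fun_prop : Continuous fun p : ℝ × Pt => p.2 + p.1 • d)) 0 1
  simp_rw [integral_fund_translate hc (hp.fderiv d)] at h1
  have h2 : ∀ x : Pt, ∫ t in (0 : ℝ)..1, fderiv ℝ f (x + t • d) d = f (x + d) - f x := by
    intro x
    have h3 : ∀ t ∈ Set.uIcc (0 : ℝ) 1, HasDerivAt (fun t : ℝ => f (x + t • d))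
        (fderiv ℝ f (x + t • d) d) t := fun t _ => by
      have h4 : HasDerivAt (fun t : ℝ => x + t • d) d t := by
        simpa using ((hasDerivAt_id t).smul_const d).const_add x
      exact (hf.differentiable one_ne_zero _).hasFDerivAt.comp_hasDerivAt t h4
    rw [intervalIntegral.integral_eq_sub_of_hasDerivAt h3
      ((hc.comp (by fun_prop : Continuous fun t : ℝ => x + t • d)).intervalIntegrable _ _)]
    simp
  simp_rw [h2] at h1
  have hfc := hf.continuous
  rw [integral_sub (f := fun x => f (x + d)) (integrable_fund (by fun_prop))
    (integrable_fund hfc), integral_fund_translate hf.continuous hp, sub_self] at h1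
  simpa using h1

theorem IsPeriodic.exists_bound {f : Pt → ℂ} (hf : Continuous f) (hp : IsPeriodic f) :
    ∃ C : ℝ, ∀ x, ‖f x‖ ≤ C := by
  obtain ⟨C, hC⟩ := isCompact_fund.exists_bound_of_continuousOn hf.continuousOn
  refine ⟨C, fun x => ?_⟩
  have h := hp (⌊x.1⌋, ⌊x.2⌋) (Int.fract x.1, Int.fract x.2)
  simp only [Int.fract_add_floor] at h
  rw [show x = (x.1, x.2) from rfl, h]
  exact hC _ ⟨⟨Int.fract_nonneg _, Int.fract_nonneg _⟩,
    ⟨(Int.fract_lt_one _).le, (Int.fract_lt_one _).le⟩⟩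

end PeriodicIntegral

section Sections

/-- The lattice point `m ∈ ℤ²` as an element of `ℝ²`. -/
def lat (m : ℤ × ℤ) : Pt := ((m.1 : ℝ), (m.2 : ℝ))

/-- The phase of the magnetic translation by `m`. -/
def latPhase (B0 : ℝ) (m : ℤ × ℤ) (x : Pt) : ℂ :=
  Complex.exp (Complex.I * ((B0 / 2 * wedge (lat m) x : ℝ) : ℂ))

theorem conj_latPhase_mul (B0 : ℝ) (m : ℤ × ℤ) (x : Pt) :
    conj (latPhase B0 m x) * latPhase B0 m x = 1 := by
  rw [latPhase, ← Complex.exp_conj, ← Complex.exp_add, map_mul, Complex.conj_I,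
    Complex.conj_ofReal, neg_mul, neg_add_cancel, Complex.exp_zero]

/-- The algebra of continuous `ℤ²`-periodic functions. -/
def Per : Subalgebra ℂ (Pt → ℂ) where
  carrier := {f | Continuous f ∧ IsPeriodic f}
  mul_mem' := fun ha hb => ⟨ha.1.mul hb.1, fun m x => by simp [ha.2 m x, hb.2 m x]⟩
  add_mem' := fun ha hb => ⟨ha.1.add hb.1, fun m x => by simp [ha.2 m x, hb.2 m x]⟩
  algebraMap_mem' := fun r => ⟨continuous_const, fun _ _ => rfl⟩

/-- Continuous functions invariant under all magnetic translations, as a submodule. -/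
def secSubmodule (B0 : ℝ) : Submodule ℂ (Pt → ℂ) where
  carrier := {f | Continuous f ∧ ∀ m x, f (x + lat m) = latPhase B0 m x * f x}
  add_mem' := fun ha hb => ⟨ha.1.add hb.1, fun m x => by simp [ha.2 m x, hb.2 m x, mul_add]⟩
  zero_mem' := ⟨continuous_const, fun _ _ => by simp⟩
  smul_mem' := fun c f hf => ⟨hf.1.const_smul c, fun m x => by
    simp only [Pi.smul_apply, smul_eq_mul, hf.2 m x]; ring⟩

/-- Continuous functions invariant under all magnetic translations. -/
def Sec (B0 : ℝ) : Type := secSubmodule B0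

variable {B0 : ℝ}

instance : AddCommGroup (Sec B0) := inferInstanceAs (AddCommGroup (secSubmodule B0))

instance : Module ℂ (Sec B0) := inferInstanceAs (Module ℂ (secSubmodule B0))

/-- The underlying function of a section. -/
def Sec.fn (f : Sec B0) : Pt → ℂ := Subtype.val f

/-- Build a section from an invariant continuous function. -/
def Sec.mk (f : Pt → ℂ) (hc : Continuous f)
    (hi : ∀ m x, f (x + lat m) = latPhase B0 m x * f x) : Sec B0 := ⟨f, hc, hi⟩

@[simp] theorem Sec.fn_mk (f : Pt → ℂ) (hc : Continuous f)
    (hi : ∀ m x, f (x + lat m) = latPhase B0 m x * f x) : (Sec.mk f hc hi).fn = f := rfl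

@[simp] theorem Sec.fn_add (f g : Sec B0) (x : Pt) : (f + g).fn x = f.fn x + g.fn x := rfl
@[simp] theorem Sec.fn_sub (f g : Sec B0) (x : Pt) : (f - g).fn x = f.fn x - g.fn x := rfl
@[simp] theorem Sec.fn_smul (c : ℂ) (f : Sec B0) (x : Pt) : (c • f).fn x = c * f.fn x := rfl

theorem Sec.ext {f g : Sec B0} (h : ∀ x, f.fn x = g.fn x) : f = g := Subtype.ext (funext h)

theorem Sec.continuous (f : Sec B0) : Continuous f.fn := f.2.1

theorem Sec.fn_add_lat (f : Sec B0) (m : ℤ × ℤ) (x : Pt) :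
    f.fn (x + lat m) = latPhase B0 m x * f.fn x := f.2.2 m x

theorem Sec.isPeriodic_conj_mul (f g : Sec B0) : IsPeriodic fun x => conj (f.fn x) * g.fn x := by
  intro m x
  change conj (f.fn (x + lat m)) * g.fn (x + lat m) = _
  rw [f.fn_add_lat, g.fn_add_lat, map_mul]
  linear_combination (conj (f.fn x) * g.fn x) * conj_latPhase_mul B0 m x

theorem Sec.continuous_conj_mul (f g : Sec B0) :
    Continuous fun x => conj (f.fn x) * g.fn x :=
  (Complex.continuous_conj.comp f.continuous).mul g.continuous

instance secCore : PreInnerProductSpace.Core ℂ (Sec B0) where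
  inner f g := ∫ x in fund, conj (f.fn x) * g.fn x
  conj_inner_symm f g := by
    rw [← integral_conj]
    refine integral_congr_ae (Eventually.of_forall fun x => ?_)
    simp [mul_comm]
  re_inner_nonneg f := by
    have h : ∀ x, conj (f.fn x) * f.fn x = ((‖f.fn x‖ ^ 2 : ℝ) : ℂ) := fun x => by
      rw [Complex.conj_mul']; push_cast; rfl
    simp_rw [h]
    rw [integral_complex_ofReal]
    exact integral_nonneg fun x => by positivity
  add_left f g k := by
    simp_rw [Sec.fn_add, map_add, add_mul]
    exact integral_add (integrable_fund (f.continuous_conj_mul k))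
      (integrable_fund (g.continuous_conj_mul k))
  smul_left f g r := by
    simp_rw [Sec.fn_smul, map_mul, mul_assoc]
    exact integral_const_mul _ _

instance : SeminormedAddCommGroup (Sec B0) :=
  InnerProductSpace.Core.toSeminormedAddCommGroup (𝕜 := ℂ)

instance : InnerProductSpace ℂ (Sec B0) := InnerProductSpace.ofCore secCore

theorem Sec.inner_def (f g : Sec B0) :
    inner ℂ f g = ∫ x in fund, conj (f.fn x) * g.fn x := rfl

theorem Sec.norm_sq (f : Sec B0) : ‖f‖ ^ 2 = ∫ x in fund, ‖f.fn x‖ ^ 2 := by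
  have h : ∀ x, conj (f.fn x) * f.fn x = ((‖f.fn x‖ ^ 2 : ℝ) : ℂ) := fun x => by
    rw [Complex.conj_mul']; push_cast; rfl
  rw [norm_sq_eq_re_inner (𝕜 := ℂ), Sec.inner_def]
  simp_rw [h]
  rw [integral_complex_ofReal]
  simp

instance : Module Per (Sec B0) where
  smul φ f := Sec.mk (fun x => φ.1 x * f.fn x) (φ.2.1.mul f.continuous) fun m x => by
    rw [f.fn_add_lat, show φ.1 (x + lat m) = φ.1 x from φ.2.2 m x]; ring
  one_smul f := Sec.ext fun x => one_mul _
  mul_smul φ ψ f := Sec.ext fun x => mul_assoc _ _ _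
  smul_zero φ := Sec.ext fun x => mul_zero _
  smul_add φ f g := Sec.ext fun x => mul_add _ _ _
  add_smul φ ψ f := Sec.ext fun x => add_mul _ _ _
  zero_smul f := Sec.ext fun x => zero_mul _

@[simp] theorem Sec.fn_per_smul (φ : Per) (f : Sec B0) (x : Pt) :
    (φ • f).fn x = φ.1 x * f.fn x := rfl

instance : SMulCommClass Per ℂ (Sec B0) where
  smul_comm φ c f := Sec.ext fun x => by simp; ring

instance : IsScalarTower ℂ Per (Sec B0) where
  smul_assoc c φ f := Sec.ext fun x => by
    change (c * φ.1 x) * f.fn x = c * (φ.1 x * f.fn x); ring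

/-- A nonnegative bound for a periodic function. -/
def perBd (φ : Per) : ℝ := max 0 (IsPeriodic.exists_bound φ.2.1 φ.2.2).choose

theorem perBd_nonneg (φ : Per) : 0 ≤ perBd φ := le_max_left _ _

theorem norm_le_perBd (φ : Per) (x : Pt) : ‖φ.1 x‖ ≤ perBd φ :=
  ((IsPeriodic.exists_bound φ.2.1 φ.2.2).choose_spec x).trans (le_max_right _ _)

theorem Sec.norm_smul_le_of_bound {φ : Per} {C : ℝ} (hC : ∀ x, ‖φ.1 x‖ ≤ C) (f : Sec B0) :
    ‖φ • f‖ ≤ C * ‖f‖ := by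
  have hC0 : 0 ≤ C := (norm_nonneg _).trans (hC 0)
  refine abs_le_of_sq_le_sq' ?_ (by positivity) |>.2
  have hf := f.continuous
  have hφ := φ.2.1
  rw [mul_pow, Sec.norm_sq, Sec.norm_sq, ← integral_const_mul]
  refine integral_mono (integrable_fund (by simp only [Sec.fn_per_smul]; fun_prop))
    (integrable_fund (by fun_prop)) fun x => ?_
  simp only [Sec.fn_per_smul, norm_mul, mul_pow]
  gcongr
  exact hC x

theorem Sec.norm_per_smul_le (φ : Per) (f : Sec B0) : ‖φ • f‖ ≤ perBd φ * ‖f‖ :=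
  Sec.norm_smul_le_of_bound (norm_le_perBd φ) f

theorem Sec.norm_inner_smul_le_of_bound {φ : Per} {C : ℝ} (hC : ∀ x, ‖φ.1 x‖ ≤ C)
    (f g : Sec B0) : ‖inner ℂ f (φ • g)‖ ≤ C * ‖f‖ * ‖g‖ := by
  refine (norm_inner_le_norm _ _).trans ?_
  rw [mul_comm C, mul_assoc]
  exact mul_le_mul_of_nonneg_left (Sec.norm_smul_le_of_bound hC g) (norm_nonneg _)

end Sections

section Magnetic

theorem wedge_self (v : Pt) : wedge v v = 0 := by simp only [wedge]; ring

/-- A smooth magnetic field on the torus with a vector potential and a Bloch parameter. -/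
structure MagData where
  /-- the Bloch parameter -/
  α : Pt
  /-- the vector potential -/
  A : Pt → Pt
  /-- the magnetic field -/
  B : Pt → ℝ
  /-- the flux -/
  B0 : ℝ
  contDiff_A : ContDiff ℝ (⊤ : ℕ∞) A
  A_add_lat : ∀ m x, A (x + lat m) = A x + A0 B0 (lat m)
  contDiff_B : ContDiff ℝ (⊤ : ℕ∞) B
  isPeriodic_B : IsPeriodic B
  curl : ∀ x v w, dotp w (fderiv ℝ A x v) - dotp v (fderiv ℝ A x w) = wedge v w * B x

namespace MagData

variable (D : MagData)

/-- The component of `α + A` in the direction `d`. -/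
def al (d x : Pt) : ℝ := dotp d (D.α + D.A x)

theorem al_add_lat (d : Pt) (m : ℤ × ℤ) (x : Pt) :
    D.al d (x + lat m) = D.al d x + D.B0 / 2 * wedge (lat m) d := by
  simp only [al, D.A_add_lat, dotp, A0, wedge, Prod.fst_add, Prod.snd_add]; ring

theorem contDiff_al (d : Pt) : ContDiff ℝ (⊤ : ℕ∞) (D.al d) := by
  have := D.contDiff_A
  unfold al dotp
  fun_prop

theorem continuous_al (d : Pt) : Continuous (D.al d) := (D.contDiff_al d).continuous

theorem fderiv_al (d x v : Pt) : fderiv ℝ (D.al d) x v = dotp d (fderiv ℝ D.A x v) := by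
  have hA : HasFDerivAt D.A (fderiv ℝ D.A x) x :=
    (D.contDiff_A.differentiable (by simp) x).hasFDerivAt
  have h1 := (hA.fst.const_add D.α.1).const_mul d.1
  have h2 := (hA.snd.const_add D.α.2).const_mul d.2
  have h := (h1.add h2).fderiv
  have : fderiv ℝ (D.al d) x = _ := h
  rw [this]
  simp [dotp]

/-- `D.DD d f g` says that `f` is continuously differentiable and that `g = (-i∂_d - α_d - A_d) f`. -/
def DD (d : Pt) (f g : Sec D.B0) : Prop :=
  ContDiff ℝ 1 f.fn ∧ ∀ x, g.fn x = -Complex.I * fderiv ℝ f.fn x d - (D.al d x : ℂ) * f.fn x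

variable {D}

theorem hasFDerivAt_latPhase (B0 : ℝ) (m : ℤ × ℤ) (x : Pt) :
    ∃ L : Pt →L[ℝ] ℂ, HasFDerivAt (latPhase B0 m) L x ∧
      ∀ d, L d = Complex.I * ((B0 / 2 * wedge (lat m) d : ℝ) : ℂ) * latPhase B0 m x := by
  let l : Pt →L[ℝ] ℝ := (B0 / 2) • ((lat m).1 • ContinuousLinearMap.snd ℝ ℝ ℝ -
    (lat m).2 • ContinuousLinearMap.fst ℝ ℝ ℝ)
  have hl : ∀ y, l y = B0 / 2 * wedge (lat m) y := fun y => by simp [l, wedge]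
  have h1 : HasFDerivAt (fun y => ((l y : ℝ) : ℂ)) (Complex.ofRealCLM.comp l) x :=
    (Complex.ofRealCLM.comp l).hasFDerivAt
  have h2 := (h1.const_mul Complex.I).cexp
  refine ⟨_, h2.congr_of_eventuallyEq (Eventually.of_forall fun y => ?_), fun d => ?_⟩
  · simp only [latPhase, hl]
  · simp [latPhase, hl]
    ring

theorem exists_DD (f : Sec D.B0) (hf : ContDiff ℝ 1 f.fn) (d : Pt) : ∃ g, D.DD d f g := by
  have hc : Continuous fun x => fderiv ℝ f.fn x d :=
    (hf.continuous_fderiv (by simp)).clm_apply continuous_const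
  have hal := D.continuous_al d
  have hfc := f.continuous
  refine ⟨Sec.mk (fun x => -Complex.I * fderiv ℝ f.fn x d - (D.al d x : ℂ) * f.fn x)
    (by fun_prop) fun m x => ?_, hf, fun x => rfl⟩
  obtain ⟨L, hL, hLd⟩ := hasFDerivAt_latPhase D.B0 m x
  have h1 : HasFDerivAt f.fn (fderiv ℝ f.fn x) x :=
    (hf.differentiable (by simp) x).hasFDerivAt
  have h2 := (hL.mul h1).fderiv
  have h3 : (latPhase D.B0 m * f.fn) = fun x => f.fn (x + lat m) := by
    funext y; exact (f.fn_add_lat m y).symm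
  rw [h3, fderiv_comp_add_right] at h2
  rw [h2, D.al_add_lat, f.fn_add_lat]
  simp [hLd]
  linear_combination (-(latPhase D.B0 m x) * f.fn x * (D.B0 / 2 * wedge (lat m) d)) * Complex.I_sq

theorem DD.contDiff_one {d : Pt} {f g : Sec D.B0} (h : D.DD d f g) (hf : ContDiff ℝ 2 f.fn) :
    ContDiff ℝ 1 g.fn := by
  have h1 : ContDiff ℝ 1 (fderiv ℝ f.fn) := hf.fderiv_right (by norm_num)
  have h2 : ContDiff ℝ 1 fun x => fderiv ℝ f.fn x d := h1.clm_apply contDiff_const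
  have h3 : ContDiff ℝ 1 (D.al d) := (D.contDiff_al d).of_le (by simp)
  have h4 : ContDiff ℝ 1 f.fn := h.1
  have h5 : ContDiff ℝ 1 (fun x => (D.al d x : ℂ)) := Complex.ofRealCLM.contDiff.comp h3
  have : g.fn = fun x => -Complex.I * fderiv ℝ f.fn x d - (D.al d x : ℂ) * f.fn x := funext h.2
  rw [this]
  fun_prop

theorem DD.fderiv_eq {d : Pt} {f g : Sec D.B0} (h : D.DD d f g) (x : Pt) :
    fderiv ℝ f.fn x d = Complex.I * (g.fn x + D.al d x * f.fn x) := by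
  rw [h.2]
  linear_combination fderiv ℝ f.fn x d * Complex.I_sq

/-- The operator `-i∂_d - α_d - A_d` is symmetric. -/
theorem DD.inner_comm {d : Pt} {f f' g g' : Sec D.B0} (hf : D.DD d f f') (hg : D.DD d g g') :
    inner ℂ f' g = inner ℂ f g' := by
  have hcf : ContDiff ℝ 1 fun x => conj (f.fn x) :=
    (Complex.conjCLE.contDiff).comp hf.1
  have h0 := integral_fund_fderiv (hcf.mul hg.1) (Sec.isPeriodic_conj_mul f g) d
  have h1 : ∀ x, fderiv ℝ (fun x => conj (f.fn x) * g.fn x) x d =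
      Complex.I * (conj (f.fn x) * g'.fn x - conj (f'.fn x) * g.fn x) := by
    intro x
    have e1 : HasFDerivAt f.fn (fderiv ℝ f.fn x) x :=
      (hf.1.differentiable (by simp) x).hasFDerivAt
    have e2 : HasFDerivAt g.fn (fderiv ℝ g.fn x) x :=
      (hg.1.differentiable (by simp) x).hasFDerivAt
    have e3 := (Complex.conjCLE.toContinuousLinearMap.hasFDerivAt.comp x e1).mul e2
    have e4 : fderiv ℝ (fun x => conj (f.fn x) * g.fn x) x = _ := e3.fderiv
    rw [e4]
    simp [hf.fderiv_eq, hg.fderiv_eq]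
    ring
  have h2 : ∫ x in fund, Complex.I * (conj (f.fn x) * g'.fn x - conj (f'.fn x) * g.fn x) = 0 := by
    rw [← h0]
    exact integral_congr_ae (Eventually.of_forall fun x => (h1 x).symm)
  rw [integral_const_mul, integral_sub (integrable_fund (f.continuous_conj_mul g'))
    (integrable_fund (f'.continuous_conj_mul g))] at h2
  rw [Sec.inner_def, Sec.inner_def]
  have := (mul_eq_zero.1 h2).resolve_left Complex.I_ne_zero
  exact (sub_eq_zero.1 this).symm

end MagData

/-- `φd` is the derivative of the continuously differentiable function `φ` along `d`. -/
def PerD (d : Pt) (φ φd : Per) : Prop :=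
  ContDiff ℝ 1 φ.1 ∧ ∀ x, φd.1 x = fderiv ℝ φ.1 x d

theorem exists_perD (φ : Per) (hφ : ContDiff ℝ 1 φ.1) (d : Pt) : ∃ φd, PerD d φ φd :=
  ⟨⟨fun x => fderiv ℝ φ.1 x d, (hφ.continuous_fderiv (by simp)).clm_apply continuous_const,
    IsPeriodic.fderiv φ.2.2 d⟩, hφ, fun _ => rfl⟩

namespace MagData

variable {D : MagData}

theorem DD.smul {d : Pt} {y y' : Sec D.B0} {φ φd : Per} (hφ : PerD d φ φd) (hy : D.DD d y y') :
    D.DD d (φ • y) (φ • y' - Complex.I • (φd • y)) := by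
  refine ⟨hφ.1.mul hy.1, fun x => ?_⟩
  have e1 : HasFDerivAt φ.1 (fderiv ℝ φ.1 x) x :=
    (hφ.1.differentiable (by simp) x).hasFDerivAt
  have e2 : HasFDerivAt y.fn (fderiv ℝ y.fn x) x :=
    (hy.1.differentiable (by simp) x).hasFDerivAt
  have e4 : fderiv ℝ (φ • y).fn x = _ := (e1.mul e2).fderiv
  rw [e4]
  simp [hy.2, hφ.2]
  ring

end MagData

end Magnetic

section Transport

/-- The integral of `g` along the segment from `x` to `x + t • k`. -/
def lineInt (k : Pt) (g : Pt → ℝ) (t : ℝ) (x : Pt) : ℝ := ∫ τ in (0 : ℝ)..t, g (x + τ • k)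

theorem continuous_lineInt (k : Pt) {g : Pt → ℝ} (hg : Continuous g) :
    Continuous fun p : ℝ × Pt => lineInt k g p.1 p.2 := by
  unfold lineInt
  refine intervalIntegral.continuous_parametric_intervalIntegral_of_continuous ?_ continuous_fst
  simp only [Function.uncurry_def]
  fun_prop

theorem continuous_lineInt_right (k : Pt) {g : Pt → ℝ} (hg : Continuous g) (t : ℝ) :
    Continuous (lineInt k g t) :=
  (continuous_lineInt k hg).comp (Continuous.prodMk_right t)

theorem lineInt_add (k : Pt) {g : Pt → ℝ} (hg : Continuous g) (t r : ℝ) (x : Pt) :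
    lineInt k g (t + r) x = lineInt k g t x + lineInt k g r (x + t • k) := by
  unfold lineInt
  have h : ∀ a b : ℝ, IntervalIntegrable (fun τ : ℝ => g (x + τ • k)) volume a b := fun a b =>
    Continuous.intervalIntegrable (by fun_prop) a b
  rw [← intervalIntegral.integral_add_adjacent_intervals (h 0 t) (h t (t + r))]
  congr 1
  have := intervalIntegral.integral_comp_add_left (a := 0) (b := r)
    (fun τ : ℝ => g (x + τ • k)) t
  rw [add_zero] at this
  rw [← this]
  simp [add_smul, add_assoc]

theorem hasFDerivAt_weighted_lineInt (k : Pt) {w : ℝ → ℝ} (hw : ContDiff ℝ 1 w) {g : Pt → ℝ}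
    (hg : ContDiff ℝ 1 g) (a b : ℝ) (x : Pt) :
    ∃ L : Pt →L[ℝ] ℝ, HasFDerivAt (fun x => ∫ τ in a..b, w τ * g (x + τ • k)) L x ∧
      ∀ d, L d = ∫ τ in a..b, w τ * fderiv ℝ g (x + τ • k) d := by
  have hF : ContDiff ℝ 1 (Function.uncurry fun (x : Pt) (τ : ℝ) => w τ * g (x + τ • k)) := by
    simp only [Function.uncurry_def]
    fun_prop
  refine ⟨_, hasFDerivAt_parametric_intervalIntegral hF a b x, fun d => ?_⟩
  have hc : Continuous fun t : ℝ => fderiv ℝ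
      (Function.uncurry fun (x : Pt) (τ : ℝ) => w τ * g (x + τ • k)) (x, t) :=
    (hF.continuous_fderiv (by simp)).comp (by fun_prop)
  rw [ContinuousLinearMap.intervalIntegral_apply
    ((hc.clm_comp continuous_const).intervalIntegrable a b)]
  refine intervalIntegral.integral_congr fun t _ => ?_
  have h1 : HasFDerivAt g (fderiv ℝ g (x + t • k)) (x + t • k) :=
    (hg.differentiable (by simp) _).hasFDerivAt
  have h2 : HasFDerivAt (fun y : Pt => y + t • k) (ContinuousLinearMap.id ℝ Pt) x :=
    (hasFDerivAt_id x).add_const _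
  have h3 := (h1.comp x h2).const_mul (w t)
  have h4 := HasFDerivAt.comp (f := fun y : Pt => (y, t)) x
    ((hF.differentiable (by simp) (x, t)).hasFDerivAt) (hasFDerivAt_prodMk_left x t)
  have h5 := h4.unique h3
  simp only [ContinuousLinearMap.comp_apply]
  have := DFunLike.congr_fun h5 d
  simpa using this

theorem hasFDerivAt_lineInt (k : Pt) {g : Pt → ℝ} (hg : ContDiff ℝ 1 g) (t : ℝ) (x : Pt) :
    ∃ L : Pt →L[ℝ] ℝ, HasFDerivAt (lineInt k g t) L x ∧
      ∀ d, L d = lineInt k (fun y => fderiv ℝ g y d) t x := by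
  obtain ⟨L, h1, h2⟩ := hasFDerivAt_weighted_lineInt k (contDiff_const (c := (1 : ℝ))) hg 0 t x
  simp only [one_mul] at h1 h2
  exact ⟨L, h1, h2⟩

theorem contDiff_lineInt (k : Pt) {n : ℕ} {g : Pt → ℝ} (hg : ContDiff ℝ n g) (t : ℝ) :
    ContDiff ℝ n (lineInt k g t) := by
  refine contDiff_parametric_intervalIntegral n ?_ 0 t
  simp only [Function.uncurry_def]
  fun_prop

theorem hasDerivAt_comp_line {E : Type*} [NormedAddCommGroup E] [NormedSpace ℝ E] {g : Pt → E}
    (hg : ContDiff ℝ 1 g) (k x : Pt) (t : ℝ) :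
    HasDerivAt (fun t : ℝ => g (x + t • k)) (fderiv ℝ g (x + t • k) k) t := by
  have h1 : HasFDerivAt g (fderiv ℝ g (x + t • k)) (x + t • k) :=
    (hg.differentiable (by simp) _).hasFDerivAt
  have h2 : HasDerivAt (fun t : ℝ => x + t • k) k t := by
    simpa using ((hasDerivAt_id t).smul_const k).const_add x
  exact h1.comp_hasDerivAt t h2

theorem lineInt_fderiv_self (k : Pt) {g : Pt → ℝ} (hg : ContDiff ℝ 1 g) (t : ℝ) (x : Pt) :
    lineInt k (fun y => fderiv ℝ g y k) t x = g (x + t • k) - g x := by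
  have h := intervalIntegral.integral_eq_sub_of_hasDerivAt (a := 0) (b := t)
    (fun s _ => hasDerivAt_comp_line hg k x s) (Continuous.intervalIntegrable (by
      have := hg.continuous_fderiv (by simp)
      fun_prop) 0 t)
  simpa [lineInt] using h

theorem IsPeriodic.comp_add {E : Type*} {f : Pt → E} (hf : IsPeriodic f) (v : Pt) :
    IsPeriodic fun x => f (x + v) := fun m x => by
  have := hf m (x + v)
  simp only [Prod.fst_add, Prod.snd_add] at this
  refine Eq.trans (congrArg f ?_) this
  ext <;> simp <;> ring

theorem IsPeriodic.lineInt {g : Pt → ℝ} (hg : IsPeriodic g) (k : Pt) (t : ℝ) :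
    IsPeriodic (lineInt k g t) := fun m x => by
  unfold _root_.lineInt
  exact intervalIntegral.integral_congr fun τ _ => hg.comp_add (τ • k) m x

/-- A continuous periodic real function as an element of `Per`. -/
def Per.ofReal (g : Pt → ℝ) (hc : Continuous g) (hp : IsPeriodic g) : Per :=
  ⟨fun x => (g x : ℂ), Complex.continuous_ofReal.comp hc, fun m x => congrArg _ (hp m x)⟩

/-- Translation of a periodic function. -/
def Per.shift (v : Pt) (φ : Per) : Per :=
  ⟨fun x => φ.1 (x + v), φ.2.1.comp (by fun_prop), φ.2.2.comp_add v⟩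

namespace MagData

variable (D : MagData)

/-- The integral of the magnetic field along segments directed by `k`. -/
def bet (k : Pt) (t : ℝ) : Per :=
  Per.ofReal (lineInt k D.B t) (continuous_lineInt_right k D.contDiff_B.continuous t)
    (D.isPeriodic_B.lineInt k t)

/-- Magnetic parallel transport along `k`: the unitary group generated by `-i∂_k - α_k - A_k`. -/
def U (k : Pt) (t : ℝ) : Sec D.B0 →ₗ[ℂ] Sec D.B0 where
  toFun f := Sec.mk
    (fun x => Complex.exp (-Complex.I * (lineInt k (D.al k) t x : ℂ)) * f.fn (x + t • k))
    (by
      have h1 : Continuous fun x => lineInt k (D.al k) t x :=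
        continuous_lineInt_right k (D.continuous_al k) t
      have h2 := f.continuous
      fun_prop)
    fun m x => by
      have h1 : lineInt k (D.al k) t (x + lat m) =
          lineInt k (D.al k) t x + t * (D.B0 / 2 * wedge (lat m) k) := by
        have hal := D.continuous_al k
        have : ∀ τ : ℝ, D.al k (x + lat m + τ • k) =
            D.al k (x + τ • k) + D.B0 / 2 * wedge (lat m) k := fun τ => by
          rw [← D.al_add_lat, add_right_comm]
        simp only [lineInt, this]
        rw [intervalIntegral.integral_add (Continuous.intervalIntegrable (by fun_prop) _ _)
          (Continuous.intervalIntegrable (by fun_prop) _ _)]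
        simp [mul_left_comm]
      rw [add_right_comm, f.fn_add_lat, h1, latPhase, latPhase, ← mul_assoc,
        ← Complex.exp_add, ← mul_assoc (Complex.exp _), ← Complex.exp_add]
      congr 2
      simp only [wedge, Prod.fst_add, Prod.snd_add, Prod.smul_fst, Prod.smul_snd, smul_eq_mul]
      push_cast
      ring
  map_add' f g := Sec.ext fun x => by simp; ring
  map_smul' c f := Sec.ext fun x => by simp; ring

theorem fn_U (k : Pt) (t : ℝ) (f : Sec D.B0) (x : Pt) : (D.U k t f).fn x =
    Complex.exp (-Complex.I * (lineInt k (D.al k) t x : ℂ)) * f.fn (x + t • k) := rfl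

theorem continuous_fn_U (k : Pt) (f : Sec D.B0) :
    Continuous fun p : ℝ × Pt => (D.U k p.1 f).fn p.2 := by
  have h1 := continuous_lineInt k (D.continuous_al k)
  have h2 := f.continuous
  simp only [fn_U]
  fun_prop

theorem U_zero (k : Pt) (f : Sec D.B0) : D.U k 0 f = f := Sec.ext fun x => by
  simp [fn_U, lineInt]

theorem U_U (k : Pt) (t r : ℝ) (f : Sec D.B0) : D.U k t (D.U k r f) = D.U k (t + r) f :=
  Sec.ext fun x => by
    rw [fn_U, fn_U, fn_U, lineInt_add k (D.continuous_al k), ← mul_assoc, ← Complex.exp_add,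
      add_smul, add_assoc]
    push_cast
    congr 2
    ring

theorem inner_U_smul_U (k : Pt) (t : ℝ) (φ : Per) (f g : Sec D.B0) :
    inner ℂ (D.U k t f) (φ • D.U k t g) = inner ℂ f (Per.shift (-(t • k)) φ • g) := by
  rw [Sec.inner_def, Sec.inner_def]
  have hc := Sec.continuous_conj_mul f (Per.shift (-(t • k)) φ • g)
  rw [← integral_fund_translate hc (Sec.isPeriodic_conj_mul _ _) (t • k)]
  refine integral_congr_ae (Eventually.of_forall fun x => ?_)
  have : conj (Complex.exp (-Complex.I * (lineInt k (D.al k) t x : ℂ))) *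
      Complex.exp (-Complex.I * (lineInt k (D.al k) t x : ℂ)) = 1 := by
    rw [← Complex.exp_conj, ← Complex.exp_add]
    simp
  simp only [fn_U, Sec.fn_per_smul, Per.shift, map_mul, add_neg_cancel_right]
  linear_combination (conj (f.fn (x + t • k)) * φ.1 x * g.fn (x + t • k)) * this

theorem inner_U_U (k : Pt) (t : ℝ) (f g : Sec D.B0) :
    inner ℂ (D.U k t f) (D.U k t g) = inner ℂ f g := by
  have := D.inner_U_smul_U k t 1 f g
  rw [one_smul] at this
  rw [this]
  congr 1
  exact Sec.ext fun x => one_mul _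

theorem norm_U (k : Pt) (t : ℝ) (f : Sec D.B0) : ‖D.U k t f‖ = ‖f‖ := by
  rw [@norm_eq_sqrt_re_inner ℂ, @norm_eq_sqrt_re_inner ℂ, inner_U_U]

variable {D}

theorem DD.transport {d : Pt} {y y' : Sec D.B0} (hy : D.DD d y y') (k : Pt) (t : ℝ) :
    D.DD d (D.U k t y) (D.U k t y' + (wedge k d : ℂ) • (D.bet k t • D.U k t y)) := by
  have hal : ContDiff ℝ 1 (D.al k) := (D.contDiff_al k).of_le (by simp)
  refine ⟨?_, fun x => ?_⟩
  · have h1 : ContDiff ℝ 1 (lineInt k (D.al k) t) := contDiff_lineInt k (n := 1) hal t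
    have h2 : ContDiff ℝ 1 y.fn := hy.1
    have : (D.U k t y).fn = fun x =>
        Complex.exp (-Complex.I * (lineInt k (D.al k) t x : ℂ)) * y.fn (x + t • k) := rfl
    rw [this]
    have h3 : ContDiff ℝ 1 fun x => (lineInt k (D.al k) t x : ℂ) :=
      Complex.ofRealCLM.contDiff.comp h1
    fun_prop
  · obtain ⟨L, hL, hLd⟩ := hasFDerivAt_lineInt k hal t x
    have e1 := ((Complex.ofRealCLM.hasFDerivAt.comp x hL).const_mul (-Complex.I)).cexp
    have e2 : HasFDerivAt (fun x => y.fn (x + t • k)) (fderiv ℝ y.fn (x + t • k)) x :=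
      ((hy.1.differentiable (by simp) (x + t • k)).hasFDerivAt).comp x
        ((hasFDerivAt_id x).add_const (t • k))
    have e3 : fderiv ℝ (D.U k t y).fn x = _ := (e1.mul e2).fderiv
    have key : D.al d (x + t • k) - D.al d x - L d = wedge k d * lineInt k D.B t x := by
      have hald : ContDiff ℝ 1 (D.al d) := (D.contDiff_al d).of_le (by simp)
      have hc := D.contDiff_A.continuous_fderiv (by simp)
      rw [hLd, ← lineInt_fderiv_self k hald]
      simp only [lineInt, fderiv_al]
      rw [← intervalIntegral.integral_sub, ← intervalIntegral.integral_const_mul]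
      · simp only [D.curl]
      · exact Continuous.intervalIntegrable (by unfold dotp; fun_prop) _ _
      · exact Continuous.intervalIntegrable (by unfold dotp; fun_prop) _ _
    have keyC : (D.al d (x + t • k) : ℂ) - D.al d x - L d = wedge k d * lineInt k D.B t x := by
      exact_mod_cast key
    rw [e3]
    simp [-Complex.coe_smul, fn_U, hy.2, bet, Per.ofReal]
    linear_combination (-Complex.exp (-(Complex.I * lineInt k (D.al k) t x)) *
      y.fn (x + t • k)) * keyC -
      (L d * Complex.exp (-(Complex.I * lineInt k (D.al k) t x)) *
      y.fn (x + t • k)) * Complex.I_sq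

/-- Integration by parts against a transported section. -/
theorem DD.inner_smul_U {d : Pt} {x x' y y' : Sec D.B0} {φ φd : Per} (hx : D.DD d x x')
    (hy : D.DD d y y') (hφ : PerD d φ φd) (k : Pt) (t : ℝ) :
    inner ℂ x' (φ • D.U k t y) = inner ℂ x (φ • D.U k t y') +
      (wedge k d : ℂ) * inner ℂ x (φ • D.bet k t • D.U k t y) -
      Complex.I * inner ℂ x (φd • D.U k t y) := by
  rw [hx.inner_comm ((hy.transport k t).smul hφ), inner_sub_right, smul_add, inner_add_right,
    inner_smul_right, smul_comm φ, inner_smul_right]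

end MagData

end Transport

section Jets

/-- Rotation by a quarter turn. -/
def perp (k : Pt) : Pt := (-k.2, k.1)

/-- The squared Euclidean norm. -/
def nsq (k : Pt) : ℝ := dotp k k

theorem wedge_perp (k : Pt) : wedge k (perp k) = nsq k := by
  simp only [wedge, perp, nsq, dotp]; ring

namespace MagData

variable (D : MagData)

/-- The magnetic field as an element of `Per`. -/
def Bp : Per := Per.ofReal D.B D.contDiff_B.continuous D.isPeriodic_B

theorem continuous_fn_U_swap (k : Pt) (f : Sec D.B0) :
    Continuous fun p : Pt × ℝ => (D.U k p.2 f).fn p.1 := by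
  have h1 : Continuous fun p : Pt × ℝ => lineInt k (D.al k) p.2 p.1 :=
    (continuous_lineInt k (D.continuous_al k)).comp continuous_swap
  have h2 := f.continuous
  simp only [fn_U]
  fun_prop

/-- The integral over `[r, T]` of the transported sections. -/
def avg (k : Pt) (y : Sec D.B0) (r T : ℝ) : Sec D.B0 :=
  Sec.mk (fun x => ∫ t in r..T, (D.U k t y).fn x)
    (by
      have h2 : Continuous (Function.uncurry fun (x : Pt) (t : ℝ) => (D.U k t y).fn x) :=
        D.continuous_fn_U_swap k y
      exact intervalIntegral.continuous_parametric_intervalIntegral_of_continuous' h2 r T)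
    fun m x => by
      simp only [Sec.fn_add_lat]
      exact intervalIntegral.integral_const_mul _ _

theorem inner_smul_avg (k : Pt) (z y : Sec D.B0) (φ : Per) (r T : ℝ) :
    inner ℂ z (φ • D.avg k y r T) = ∫ t in r..T, inner ℂ z (φ • D.U k t y) := by
  have h1 := D.continuous_fn_U k y
  have h2 := z.continuous
  have h3 := φ.2.1
  simp only [Sec.inner_def]
  rw [integral_fund_swap]
  · refine integral_congr_ae (Eventually.of_forall fun x => ?_)
    simp only [Sec.fn_per_smul, avg, Sec.fn_mk]
    rw [← intervalIntegral.integral_const_mul, ← intervalIntegral.integral_const_mul]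
  · simp only [Function.uncurry_def, Sec.fn_per_smul]
    fun_prop

theorem continuous_inner_smul_U (k : Pt) (z y : Sec D.B0) (φ : Per) :
    Continuous fun t => inner ℂ z (φ • D.U k t y) := by
  have h1 := D.continuous_fn_U k y
  have h2 := z.continuous
  have h3 := φ.2.1
  simp only [Sec.inner_def]
  refine continuous_parametric_integral_of_continuous ?_ isCompact_fund
  simp only [Function.uncurry_def, Sec.fn_per_smul]
  fun_prop

variable {D}

theorem DD.U_sub_U {k : Pt} {y y' : Sec D.B0} (hy : D.DD k y y') (r T : ℝ) :
    D.U k T y - D.U k r y = Complex.I • D.avg k y' r T := Sec.ext fun x => by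
  have h1 : ∀ t, HasDerivAt (fun t => (D.U k t y).fn x) (Complex.I * (D.U k t y').fn x) t := by
    intro t
    have hal : Continuous fun τ : ℝ => D.al k (x + τ • k) := by
      have := D.continuous_al k
      fun_prop
    have e1 : HasDerivAt (fun t => lineInt k (D.al k) t x) (D.al k (x + t • k)) t :=
      intervalIntegral.integral_hasDerivAt_right (hal.intervalIntegrable _ _)
        (hal.stronglyMeasurableAtFilter _ _) hal.continuousAt
    have e2 := (e1.ofReal_comp.const_mul (-Complex.I)).cexp
    have e3 := e2.mul (hasDerivAt_comp_line hy.1 k x t)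
    refine e3.congr_deriv ?_
    rw [hy.fderiv_eq, fn_U]
    ring
  have h2 : Continuous fun t => Complex.I * (D.U k t y').fn x := by
    have := (D.continuous_fn_U k y').comp (Continuous.prodMk_left x)
    exact continuous_const.mul this
  have h3 := intervalIntegral.integral_eq_sub_of_hasDerivAt (a := r) (b := T)
    (fun t _ => h1 t) (h2.intervalIntegrable _ _)
  rw [intervalIntegral.integral_const_mul] at h3
  simp only [Sec.fn_sub, Sec.fn_smul, avg, Sec.fn_mk]
  exact h3.symm

/-- The time integral of a transported derivative telescopes. -/
theorem DD.integral_inner_smul_U {k : Pt} {y y' : Sec D.B0} (hy : D.DD k y y') (z : Sec D.B0)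
    (φ : Per) (r T : ℝ) :
    ∫ t in r..T, inner ℂ z (φ • D.U k t y') =
      -Complex.I * (inner ℂ z (φ • D.U k T y) - inner ℂ z (φ • D.U k r y)) := by
  rw [← inner_smul_avg, ← inner_sub_right, ← smul_sub, hy.U_sub_U, smul_comm φ, inner_smul_right]
  linear_combination inner ℂ z (φ • D.avg k y' r T) * Complex.I_sq

theorem DD.unique {d : Pt} {f g g' : Sec D.B0} (h : D.DD d f g) (h' : D.DD d f g') : g = g' :=
  Sec.ext fun x => by rw [h.2, h'.2]

theorem DD.combine {d e : Pt} {f g g' : Sec D.B0} (h : D.DD d f g) (h' : D.DD e f g') (a b : ℝ) :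
    D.DD (a • d + b • e) f ((a : ℂ) • g + (b : ℂ) • g') := by
  refine ⟨h.1, fun x => ?_⟩
  rw [map_add, map_smul, map_smul, Sec.fn_add, Sec.fn_smul, Sec.fn_smul, h.2, h'.2]
  simp [al, dotp]
  ring

theorem DD.linear {d : Pt} {f f' g g' : Sec D.B0} (h : D.DD d f f') (h' : D.DD d g g') (a b : ℂ) :
    D.DD d (a • f + b • g) (a • f' + b • g') := by
  refine ⟨(h.1.const_smul a).add (h'.1.const_smul b), fun x => ?_⟩
  have e1 : HasFDerivAt f.fn (fderiv ℝ f.fn x) x :=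
    (h.1.differentiable (by simp) x).hasFDerivAt
  have e2 : HasFDerivAt g.fn (fderiv ℝ g.fn x) x :=
    (h'.1.differentiable (by simp) x).hasFDerivAt
  have e3 : fderiv ℝ (a • f + b • g).fn x = _ := ((e1.const_smul a).add (e2.const_smul b)).fderiv
  rw [e3]
  simp [h.2, h'.2]
  ring

/-- The commutator of two covariant derivatives is multiplication by the magnetic field. -/
theorem DD.commutator {d e : Pt} {f fd fe fde fed : Sec D.B0} (hf : ContDiff ℝ 2 f.fn)
    (hd : D.DD d f fd) (he : D.DD e f fe) (hde : D.DD d fe fde) (hed : D.DD e fd fed) :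
    fde = fed + (Complex.I * wedge d e) • (D.Bp • f) := Sec.ext fun x => by
  have key : ∀ {a b : Pt} {g g' : Sec D.B0}, D.DD b f g → D.DD a g g' →
      g'.fn x = -fderiv ℝ (fderiv ℝ f.fn) x a b +
        Complex.I * (dotp b (fderiv ℝ D.A x a) : ℝ) * f.fn x +
        Complex.I * D.al b x * fderiv ℝ f.fn x a + Complex.I * D.al a x * fderiv ℝ f.fn x b +
        D.al a x * D.al b x * f.fn x := by
    intro a b g g' h h'
    have e1 : HasFDerivAt f.fn (fderiv ℝ f.fn x) x :=
      (h.1.differentiable (by simp) x).hasFDerivAt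
    have hf2 : ContDiff ℝ 1 (fderiv ℝ f.fn) := hf.fderiv_right (by norm_num)
    have e2 := ((hf2.differentiable (by simp) x).hasFDerivAt).clm_apply (hasFDerivAt_const b x)
    have e3 := ((((D.contDiff_al b).differentiable (by simp) x).hasFDerivAt))
    have e4 := Complex.ofRealCLM.hasFDerivAt.comp x e3
    have e5 := (e2.const_mul (-Complex.I)).sub (e4.mul e1)
    have e6 : fderiv ℝ g.fn x = _ := (e5.congr_of_eventuallyEq
      (Eventually.of_forall fun y => h.2 y)).fderiv
    rw [h'.2, e6, h.2]
    simp [fderiv_al]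
    linear_combination fderiv ℝ (fderiv ℝ f.fn) x a b * Complex.I_sq
  have hsymm : fderiv ℝ (fderiv ℝ f.fn) x d e = fderiv ℝ (fderiv ℝ f.fn) x e d :=
    (hf.contDiffAt.isSymmSndFDerivAt (by simp)) d e
  have hc : (dotp e (fderiv ℝ D.A x d) : ℂ) - dotp d (fderiv ℝ D.A x e) = wedge d e * D.B x := by
    exact_mod_cast D.curl x d e
  rw [Sec.fn_add, Sec.fn_smul, Sec.fn_per_smul, key he hde, key hd hed, hsymm]
  simp only [Bp, Per.ofReal]
  linear_combination (Complex.I * f.fn x) * hc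

/-- The derivatives up to order two of a section `u` in the directions `k` and `k^⊥`, for a
solution of `h² L u = u + e`. -/
structure Jet (D : MagData) (k : Pt) (h : ℝ) (u e : Sec D.B0) where
  /-- first derivative along `k` -/
  P : Sec D.B0
  /-- first derivative along `k^⊥` -/
  R : Sec D.B0
  /-- second derivative along `k`, `k` -/
  PP : Sec D.B0
  /-- the `k` derivative of `R` -/
  PR : Sec D.B0
  /-- the `k^⊥` derivative of `P` -/
  RP : Sec D.B0
  /-- second derivative along `k^⊥`, `k^⊥` -/
  RR : Sec D.B0
  hP : D.DD k u P
  hR : D.DD (perp k) u R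
  hPP : D.DD k P PP
  hPR : D.DD k R PR
  hRP : D.DD (perp k) P RP
  hRR : D.DD (perp k) R RR
  comm : PR = RP + (Complex.I * nsq k) • (D.Bp • u)
  eqn : ((h : ℂ) ^ 2) • (PP + RR) = (nsq k : ℂ) • (u + e)

theorem exists_jet (u e : Sec D.B0) (hu : ContDiff ℝ 2 u.fn) (k : Pt) (h : ℝ)
    (he : ∀ x, e.fn x = ((h ^ 2 : ℝ) : ℂ) * magLap D.α D.A u.fn x - u.fn x) :
    Nonempty (D.Jet k h u e) := by
  have hu1 : ContDiff ℝ 1 u.fn := hu.of_le (by norm_num)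
  obtain ⟨P, hP⟩ := exists_DD u hu1 k
  obtain ⟨R, hR⟩ := exists_DD u hu1 (perp k)
  obtain ⟨PP, hPP⟩ := exists_DD P (hP.contDiff_one hu) k
  obtain ⟨RP, hRP⟩ := exists_DD P (hP.contDiff_one hu) (perp k)
  obtain ⟨PR, hPR⟩ := exists_DD R (hR.contDiff_one hu) k
  obtain ⟨RR, hRR⟩ := exists_DD R (hR.contDiff_one hu) (perp k)
  obtain ⟨a, ha⟩ := exists_DD u hu1 (1, 0)
  obtain ⟨b, hb⟩ := exists_DD u hu1 (0, 1)
  obtain ⟨aa, haa⟩ := exists_DD a (ha.contDiff_one hu) (1, 0)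
  obtain ⟨ab, hab⟩ := exists_DD b (hb.contDiff_one hu) (1, 0)
  obtain ⟨ba, hba⟩ := exists_DD a (ha.contDiff_one hu) (0, 1)
  obtain ⟨bb, hbb⟩ := exists_DD b (hb.contDiff_one hu) (0, 1)
  have hk : ∀ v : Pt, v.1 • ((1, 0) : Pt) + v.2 • ((0, 1) : Pt) = v := fun v => by
    ext <;> simp
  have second : ∀ (v : Pt) {V VV : Sec D.B0}, D.DD v u V → D.DD v V VV →
      VV = (v.1 : ℂ) • ((v.1 : ℂ) • aa + (v.2 : ℂ) • ab) +
        (v.2 : ℂ) • ((v.1 : ℂ) • ba + (v.2 : ℂ) • bb) := by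
    intro v V VV h1 h2
    have e1 := ha.combine hb v.1 v.2
    rw [hk] at e1
    have e2 := (haa.linear hab v.1 v.2).combine (hba.linear hbb v.1 v.2) v.1 v.2
    rw [hk, ← h1.unique e1] at e2
    exact h2.unique e2
  have hdop1 : ∀ {f g : Sec D.B0}, D.DD (1, 0) f g → Dop1 D.α D.A f.fn = g.fn := by
    intro f g h
    funext x
    rw [h.2]
    simp [Dop1, pd1, al, dotp]
  have hdop2 : ∀ {f g : Sec D.B0}, D.DD (0, 1) f g → Dop2 D.α D.A f.fn = g.fn := by
    intro f g h
    funext x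
    rw [h.2]
    simp [Dop2, pd2, al, dotp]
  have hlap : ∀ x, magLap D.α D.A u.fn x = aa.fn x + bb.fn x := fun x => by
    rw [magLap, hdop1 ha, hdop1 haa, hdop2 hb, hdop2 hbb]
  refine ⟨P, R, PP, PR, RP, RR, hP, hR, hPP, hPR, hRP, hRR, ?_, ?_⟩
  · rw [← wedge_perp]
    exact hP.commutator hu hR hPR hRP
  · refine Sec.ext fun x => ?_
    rw [second k hP hPP, second (perp k) hR hRR]
    simp only [Sec.fn_smul, Sec.fn_add, he, hlap, perp, nsq, dotp]
    push_cast
    ring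

end MagData

end Jets

section Identities

namespace MagData

variable {D : MagData} {k : Pt} {h : ℝ} {u e : Sec D.B0}

theorem DD.inner_smul_U_self {x x' y y' : Sec D.B0} {φ φd : Per} (hx : D.DD k x x')
    (hy : D.DD k y y') (hφ : PerD k φ φd) (t : ℝ) :
    inner ℂ x' (φ • D.U k t y) = inner ℂ x (φ • D.U k t y') -
      Complex.I * inner ℂ x (φd • D.U k t y) := by
  rw [hx.inner_smul_U hy hφ, wedge_self]
  simp

theorem DD.inner_smul_U_perp {x x' y y' : Sec D.B0} {φ φd : Per} (hx : D.DD (perp k) x x')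
    (hy : D.DD (perp k) y y') (hφ : PerD (perp k) φ φd) (t : ℝ) :
    inner ℂ x' (φ • D.U k t y) = inner ℂ x (φ • D.U k t y') +
      (nsq k : ℂ) * inner ℂ x (φ • D.bet k t • D.U k t y) -
      Complex.I * inner ℂ x (φd • D.U k t y) := by
  rw [hx.inner_smul_U hy hφ, wedge_perp]

theorem perD_one (d : Pt) : PerD d 1 0 :=
  ⟨contDiff_const, fun x => by
    have : (1 : Per).1 = fun _ => (1 : ℂ) := rfl
    rw [this, fderiv_const_apply]
    rfl⟩

namespace Jet

variable (J : D.Jet k h u e)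

theorem eqn_left (φ : Per) (t : ℝ) (y : Sec D.B0) :
    (h : ℂ) ^ 2 * (inner ℂ J.PP (φ • D.U k t y) + inner ℂ J.RR (φ • D.U k t y)) =
      nsq k * (inner ℂ u (φ • D.U k t y) + inner ℂ e (φ • D.U k t y)) := by
  have := congrArg (fun z => inner ℂ z (φ • D.U k t y)) J.eqn
  simpa only [inner_smul_left, inner_add_left, map_pow, Complex.conj_ofReal] using this

theorem eqn_right (φ : Per) (t : ℝ) (x : Sec D.B0) :
    (h : ℂ) ^ 2 * (inner ℂ x (φ • D.U k t J.PP) + inner ℂ x (φ • D.U k t J.RR)) =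
      nsq k * (inner ℂ x (φ • D.U k t u) + inner ℂ x (φ • D.U k t e)) := by
  have := congrArg (fun z => inner ℂ x (φ • D.U k t z)) J.eqn
  simp only [map_smul, map_add, smul_comm φ, inner_smul_right, inner_add_right, smul_add] at this
  rw [mul_add, mul_add, this]

theorem comm_left (φ : Per) (t : ℝ) (y : Sec D.B0) :
    inner ℂ J.PR (φ • D.U k t y) = inner ℂ J.RP (φ • D.U k t y) -
      Complex.I * nsq k * inner ℂ (D.Bp • u) (φ • D.U k t y) := by
  rw [J.comm, inner_add_left, inner_smul_left, map_mul, Complex.conj_I, Complex.conj_ofReal]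
  ring

theorem comm_right (φ : Per) (t : ℝ) (x : Sec D.B0) :
    inner ℂ x (φ • D.U k t J.PR) = inner ℂ x (φ • D.U k t J.RP) +
      Complex.I * nsq k * inner ℂ x (φ • D.U k t (D.Bp • u)) := by
  rw [J.comm, map_add, map_smul, smul_add, inner_add_right, smul_comm φ (Complex.I * _),
    inner_smul_right]

/-- Energy identity. -/
theorem energy {φ φk φp : Per} (hk : PerD k φ φk) (hp : PerD (perp k) φ φp) (t : ℝ) :
    nsq k * (inner ℂ u (φ • D.U k t u) + inner ℂ e (φ • D.U k t u)) =
      (h : ℂ) ^ 2 * (inner ℂ J.P (φ • D.U k t J.P) - Complex.I * inner ℂ J.P (φk • D.U k t u) +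
        inner ℂ J.R (φ • D.U k t J.R) + nsq k * inner ℂ J.R (φ • D.bet k t • D.U k t u) -
        Complex.I * inner ℂ J.R (φp • D.U k t u)) := by
  have s1 := J.hPP.inner_smul_U_self J.hP hk t
  have s2 := J.hRR.inner_smul_U_perp J.hR hp t
  linear_combination -J.eqn_left φ t u + (h : ℂ) ^ 2 * s1 + (h : ℂ) ^ 2 * s2

/-- Commutator of the Laplacian with a transported multiplication operator. -/
theorem commutator_mul {a ak ap akk : Per} (hk : PerD k a ak) (hp : PerD (perp k) a ap)
    (hkk : PerD k ak akk) (t : ℝ) :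
    nsq k * (inner ℂ e (a • D.U k t u) - inner ℂ u (a • D.U k t e)) =
      (h : ℂ) ^ 2 * (-Complex.I * (2 * inner ℂ u (ak • D.U k t J.P) -
          Complex.I * inner ℂ u (akk • D.U k t u)) +
        nsq k * (inner ℂ J.R (a • D.bet k t • D.U k t u) +
          inner ℂ u (a • D.bet k t • D.U k t J.R)) -
        Complex.I * (inner ℂ J.R (ap • D.U k t u) + inner ℂ u (ap • D.U k t J.R))) := by
  have s1 := J.hPP.inner_smul_U_self J.hP hk t
  have s2 := J.hP.inner_smul_U_self J.hPP hk t
  have s3 := J.hP.inner_smul_U_self J.hP hkk t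
  have s4 := J.hRR.inner_smul_U_perp J.hR hp t
  have s5 := J.hR.inner_smul_U_perp J.hRR hp t
  linear_combination -J.eqn_left a t u + J.eqn_right a t u + (h : ℂ) ^ 2 * (s1 + s2 + s4 + s5) -
    (h : ℂ) ^ 2 * Complex.I * s3

/-- Commutator of the Laplacian with a transported derivative across the direction `k`. -/
theorem commutator_deriv {ψ ψk ψp : Per} (hk : PerD k ψ ψk) (hp : PerD (perp k) ψ ψp) (t : ℝ) :
    (h : ℂ) ^ 2 * (-Complex.I * inner ℂ J.R (ψp • D.U k t J.R)) =
      nsq k * (inner ℂ e (ψ • D.U k t J.R) - inner ℂ J.R (ψ • D.U k t e) +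
        Complex.I * inner ℂ u (ψp • D.U k t u) -
        nsq k * inner ℂ u (ψ • D.bet k t • D.U k t u)) +
      (h : ℂ) ^ 2 * (Complex.I * inner ℂ J.P (ψk • D.U k t J.R) +
        Complex.I * inner ℂ J.R (ψk • D.U k t J.P) - Complex.I * inner ℂ J.P (ψp • D.U k t J.P) +
        nsq k * inner ℂ J.P (ψ • D.bet k t • D.U k t J.P) -
        nsq k * inner ℂ J.R (ψ • D.bet k t • D.U k t J.R) -
        Complex.I * nsq k * inner ℂ J.P (ψ • D.U k t (D.Bp • u)) -
        Complex.I * nsq k * inner ℂ (D.Bp • u) (ψ • D.U k t J.P)) := by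
  have s1 := J.hRR.inner_smul_U_perp J.hRR hp t
  have s2 := J.hPP.inner_smul_U_self J.hPR hk t
  have s3 := J.hPR.inner_smul_U_self J.hPP hk t
  have s4 := J.hRP.inner_smul_U_perp J.hRP hp t
  have s5 := J.hR.inner_smul_U_perp J.hR hp t
  have c1 := J.comm_right ψ t J.P
  have c2 := J.comm_left ψ t J.P
  linear_combination -(h : ℂ) ^ 2 * s1 + J.eqn_left ψ t J.R - J.eqn_right ψ t J.R -
    (h : ℂ) ^ 2 * (s2 + s3 + c1 - c2 - s4) - nsq k * s5

theorem norm_sq_add (hu : ‖u‖ = 1) :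
    h ^ 2 * (‖J.P‖ ^ 2 + ‖J.R‖ ^ 2) ≤ nsq k * (1 + ‖e‖) := by
  have hk : 0 ≤ nsq k := by simp only [nsq, dotp]; nlinarith [sq_nonneg k.1, sq_nonneg k.2]
  have h0 := congrArg (fun z => inner ℂ z u) J.eqn
  simp only [inner_smul_left, inner_add_left, map_pow, Complex.conj_ofReal] at h0
  rw [J.hPP.inner_comm J.hP, J.hRR.inner_comm J.hR, inner_self_eq_norm_sq_to_K,
    inner_self_eq_norm_sq_to_K, inner_self_eq_norm_sq_to_K, hu] at h0
  have h1 : h ^ 2 * (‖J.P‖ ^ 2 + ‖J.R‖ ^ 2) = nsq k * (1 + (inner ℂ e u).re) := by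
    have := congrArg Complex.re h0
    simp only [Complex.coe_algebraMap, ← Complex.ofReal_pow, ← Complex.ofReal_add,
      Complex.re_ofReal_mul, Complex.ofReal_re, Complex.add_re] at this
    simpa using this
  rw [h1]
  gcongr
  refine (Complex.re_le_norm _).trans ?_
  simpa [hu] using norm_inner_le_norm (𝕜 := ℂ) e u

end Jet

end MagData

end Identities

section Estimates

open Asymptotics

namespace MagData

variable {D : MagData} {k : Pt}

theorem norm_comp_add_sub_le {φ φk : Per} (hφ : PerD k φ φk) (x : Pt) (τ : ℝ) :
    ‖φ.1 (x + τ • k) - φ.1 x‖ ≤ perBd φk * |τ| := by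
  have h := convex_univ.norm_image_sub_le_of_norm_hasDerivWithin_le (C := perBd φk)
    (f := fun t : ℝ => φ.1 (x + t • k)) (x := 0) (y := τ)
    (fun t _ => (hasDerivAt_comp_line hφ.1 k x t).hasDerivWithinAt)
    (fun t _ => by rw [← hφ.2]; exact norm_le_perBd _ _) (Set.mem_univ _) (Set.mem_univ _)
  simpa using h

theorem contDiff_Bp (n : ℕ) : ContDiff ℝ n D.Bp.1 :=
  Complex.ofRealCLM.contDiff.comp (D.contDiff_B.of_le (by exact_mod_cast le_top))

theorem norm_bet_le {t : ℝ} (ht : 0 ≤ t) (x : Pt) : ‖(D.bet k t).1 x‖ ≤ perBd D.Bp * t := by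
  have h := intervalIntegral.norm_integral_le_of_norm_le_const (a := 0) (b := t)
    (f := fun τ => D.B (x + τ • k)) (C := perBd D.Bp) fun τ _ => by
      simpa [Bp, Per.ofReal] using norm_le_perBd D.Bp (x + τ • k)
  simpa [bet, Per.ofReal, lineInt, abs_of_nonneg ht] using h

theorem exists_norm_bet_sub_le (D : MagData) (k : Pt) : ∃ C, 0 ≤ C ∧ ∀ t, 0 ≤ t → ∀ x,
    ‖(D.bet k t - (t : ℂ) • D.Bp).1 x‖ ≤ C * t ^ 2 := by
  obtain ⟨Bk, hBk⟩ := exists_perD D.Bp (contDiff_Bp 1) k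
  refine ⟨perBd Bk, perBd_nonneg _, fun t ht x => ?_⟩
  have hB := D.contDiff_B.continuous
  have h1 : (D.bet k t - (t : ℂ) • D.Bp).1 x =
      ((∫ τ in (0 : ℝ)..t, (D.B (x + τ • k) - D.B x) : ℝ) : ℂ) := by
    rw [intervalIntegral.integral_sub (Continuous.intervalIntegrable (by fun_prop) _ _)
      intervalIntegrable_const]
    simp [bet, Bp, Per.ofReal, lineInt]
  rw [h1, Complex.norm_real]
  have h2 := intervalIntegral.norm_integral_le_of_norm_le_const (a := 0) (b := t)
    (f := fun τ => D.B (x + τ • k) - D.B x) (C := perBd Bk * t) fun τ hτ => by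
      have hτ' : τ ∈ Set.Ioc 0 t := by rwa [Set.uIoc_of_le ht] at hτ
      have := norm_comp_add_sub_le hBk x τ
      rw [show D.Bp.1 (x + τ • k) - D.Bp.1 x = ((D.B (x + τ • k) - D.B x : ℝ) : ℂ) by
        simp [Bp, Per.ofReal], Complex.norm_real, abs_of_pos hτ'.1] at this
      exact this.trans (mul_le_mul_of_nonneg_left hτ'.2 (perBd_nonneg _))
  refine h2.trans_eq ?_
  rw [sub_zero, abs_of_nonneg ht]
  ring

/-- A quasimode together with its derivatives and a transport time `t ≤ √h`. -/
structure Cfg (D : MagData) (k : Pt) where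
  /-- semiclassical parameter -/
  h : ℝ
  /-- transport time -/
  t : ℝ
  /-- the quasimode -/
  u : Sec D.B0
  /-- the error -/
  e : Sec D.B0
  /-- the derivatives of the quasimode -/
  jet : D.Jet k h u e
  h_pos : 0 < h
  h_le : h ≤ 1
  norm_u : ‖u‖ = 1
  norm_e : ‖e‖ ≤ 1
  t_nonneg : 0 ≤ t
  t_sq : t ^ 2 ≤ h

namespace Cfg

theorem t_le (c : Cfg D k) : c.t ≤ 1 := by
  nlinarith [c.t_sq, c.h_le, c.t_nonneg]

theorem isBigO_mono {E : Type*} [SeminormedAddCommGroup E] {F : Cfg D k → E}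
    {f g : Cfg D k → ℝ} (hF : F =O[⊤] f) (hfg : ∀ c, |f c| ≤ g c) : F =O[⊤] g :=
  hF.trans (IsBigO.of_bound 1 (Eventually.of_forall fun c => by
    rw [one_mul, Real.norm_eq_abs, Real.norm_eq_abs]
    exact (hfg c).trans (le_abs_self _)))

theorem isBigO_real_mul {F : Cfg D k → ℂ} {f : Cfg D k → ℝ} (r : Cfg D k → ℝ) (hF : F =O[⊤] f) :
    (fun c => (r c : ℂ) * F c) =O[⊤] fun c => r c * f c :=
  (IsBigO.of_bound 1 (Eventually.of_forall fun c => by simp)).mul hF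

theorem isBigO_u : (fun c : Cfg D k => c.u) =O[⊤] fun _ => (1 : ℝ) :=
  IsBigO.of_bound 1 (Eventually.of_forall fun c => by simp [c.norm_u])

theorem isBigO_e : (fun c : Cfg D k => c.e) =O[⊤] fun c => ‖c.e‖ :=
  IsBigO.of_bound 1 (Eventually.of_forall fun c => by simp)

theorem isBigO_Bu : (fun c : Cfg D k => D.Bp • c.u) =O[⊤] fun _ => (1 : ℝ) :=
  IsBigO.of_bound (perBd D.Bp) (Eventually.of_forall fun c => by
    simpa [c.norm_u] using Sec.norm_per_smul_le D.Bp c.u)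

theorem norm_le_of_sq (c : Cfg D k) {x : ℝ}
    (h : c.h ^ 2 * x ^ 2 ≤ nsq k * (1 + ‖c.e‖)) : x ≤ (1 + |nsq k|) * (1 / c.h) := by
  have h1 : (c.h * x) ^ 2 ≤ (1 + |nsq k|) ^ 2 := by
    rw [mul_pow]
    nlinarith [c.norm_e, le_abs_self (nsq k), abs_nonneg (nsq k), norm_nonneg c.e, sq_nonneg |nsq k|,
      mul_nonneg (sub_nonneg.2 (le_abs_self (nsq k))) (norm_nonneg c.e),
      mul_nonneg (abs_nonneg (nsq k)) (sub_nonneg.2 c.norm_e)]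
  have h2 : c.h * x ≤ 1 + |nsq k| :=
    (abs_le_of_sq_le_sq' h1 (by positivity)).2
  rw [mul_one_div, le_div_iff₀ c.h_pos]
  linarith

theorem isBigO_P : (fun c : Cfg D k => c.jet.P) =O[⊤] fun c => 1 / c.h :=
  IsBigO.of_bound (1 + |nsq k|) (Eventually.of_forall fun c => by
    rw [Real.norm_of_nonneg (by have := c.h_pos; positivity)]
    refine c.norm_le_of_sq (le_trans ?_ (c.jet.norm_sq_add c.norm_u))
    gcongr
    nlinarith [sq_nonneg ‖c.jet.R‖])

theorem isBigO_R : (fun c : Cfg D k => c.jet.R) =O[⊤] fun c => 1 / c.h :=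
  IsBigO.of_bound (1 + |nsq k|) (Eventually.of_forall fun c => by
    rw [Real.norm_of_nonneg (by have := c.h_pos; positivity)]
    refine c.norm_le_of_sq (le_trans ?_ (c.jet.norm_sq_add c.norm_u))
    gcongr
    nlinarith [sq_nonneg ‖c.jet.P‖])

variable {x y : Cfg D k → Sec D.B0} {f g : Cfg D k → ℝ}

theorem isBigO_inner_of_bound {w : ℝ → Per} {b : ℝ → ℝ} {M : ℝ}
    (hM : 0 ≤ M) (hw : ∀ c : Cfg D k, ∀ z, ‖(w c.t).1 z‖ ≤ M * b c.t) (hx : x =O[⊤] f) (hy : y =O[⊤] g) :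
    (fun c => inner ℂ (x c) (w c.t • D.U k c.t (y c))) =O[⊤] fun c => b c.t * (f c * g c) := by
  obtain ⟨C₁, h₁⟩ := isBigO_top.1 hx
  obtain ⟨C₂, h₂⟩ := isBigO_top.1 hy
  refine IsBigO.of_bound (M * C₁ * C₂) (Eventually.of_forall fun c => ?_)
  have h0 : 0 ≤ M * b c.t := (norm_nonneg _).trans (hw c 0)
  calc ‖inner ℂ (x c) (w c.t • D.U k c.t (y c))‖
      ≤ M * b c.t * ‖x c‖ * ‖D.U k c.t (y c)‖ := Sec.norm_inner_smul_le_of_bound (hw c) _ _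
    _ ≤ M * b c.t * (C₁ * ‖f c‖) * (C₂ * ‖g c‖) := by
        rw [norm_U]
        have := h₁ c
        have := h₂ c
        have : 0 ≤ C₁ * ‖f c‖ := (norm_nonneg _).trans (h₁ c)
        gcongr
    _ = (M * b c.t) * C₁ * C₂ * (‖f c‖ * ‖g c‖) := by ring
    _ ≤ M * C₁ * C₂ * ‖b c.t * (f c * g c)‖ := by
        rw [norm_mul, norm_mul]
        have e1 : 0 ≤ (C₁ * ‖f c‖) * (C₂ * ‖g c‖) :=
          mul_nonneg ((norm_nonneg _).trans (h₁ c)) ((norm_nonneg _).trans (h₂ c))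
        have e2 : M * b c.t ≤ M * ‖b c.t‖ := mul_le_mul_of_nonneg_left (le_abs_self _) hM
        nlinarith [mul_le_mul_of_nonneg_right e2 e1]

theorem isBigO_inner (φ : Per) (hx : x =O[⊤] f) (hy : y =O[⊤] g) :
    (fun c => inner ℂ (x c) (φ • D.U k c.t (y c))) =O[⊤] fun c => f c * g c := by
  simpa using isBigO_inner_of_bound (w := fun _ => φ) (b := fun _ => 1) (perBd_nonneg φ)
    (fun c z => by simpa using norm_le_perBd φ z) hx hy

theorem isBigO_inner_bet (φ : Per) (hx : x =O[⊤] f) (hy : y =O[⊤] g) :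
    (fun c => inner ℂ (x c) (φ • D.bet k c.t • D.U k c.t (y c))) =O[⊤]
      fun c => c.t * (f c * g c) := by
  have := isBigO_inner_of_bound (w := fun t => φ * D.bet k t) (b := fun t => t)
    (M := perBd φ * perBd D.Bp) (mul_nonneg (perBd_nonneg _) (perBd_nonneg _))
    (fun c z => by
      change ‖φ.1 z * (D.bet k c.t).1 z‖ ≤ _
      rw [norm_mul, mul_assoc]
      exact mul_le_mul (norm_le_perBd _ _) (norm_bet_le c.t_nonneg z) (norm_nonneg _)
        (perBd_nonneg _)) hx hy
  simpa only [mul_smul] using this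

theorem isBigO_inner_bet_sub (hx : x =O[⊤] f) (hy : y =O[⊤] g) :
    (fun c => inner ℂ (x c) (D.bet k c.t • D.U k c.t (y c)) -
      c.t * inner ℂ (x c) (D.Bp • D.U k c.t (y c))) =O[⊤] fun c => c.t ^ 2 * (f c * g c) := by
  obtain ⟨C, hC, hb⟩ := exists_norm_bet_sub_le D k
  have := isBigO_inner_of_bound (w := fun t => D.bet k t - (t : ℂ) • D.Bp) (b := fun t => t ^ 2)
    hC (fun c z => hb c.t c.t_nonneg z) hx hy
  simpa only [sub_smul, inner_sub_right, smul_assoc, inner_smul_right] using this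

/-- The size of the error terms. -/
def err (c : Cfg D k) : ℝ := ‖c.e‖ / c.h + c.h

theorem err_nonneg (c : Cfg D k) : 0 ≤ c.err := by
  have := c.h_pos; unfold err; positivity

end Cfg

end MagData

end Estimates

section Claims

open Asymptotics

namespace MagData

variable {D : MagData} {k : Pt}

namespace Cfg

theorem norm_e_div_le (c : Cfg D k) : ‖c.e‖ / c.h ≤ c.err := by
  have := c.h_pos; unfold err; linarith

theorem norm_e_le (c : Cfg D k) : ‖c.e‖ ≤ c.err :=
  (le_div_self (norm_nonneg _) c.h_pos c.h_le).trans c.norm_e_div_le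

theorem h_le_err (c : Cfg D k) : c.h ≤ c.err := by
  have := c.h_pos
  have : 0 ≤ ‖c.e‖ / c.h := by positivity
  unfold err; linarith

theorem t_sq_le_err (c : Cfg D k) : c.t ^ 2 ≤ c.err := c.t_sq.trans c.h_le_err

variable {f g : Cfg D k → ℝ}

theorem isBigO_inner_e_R (φ : Per) :
    (fun c : Cfg D k => inner ℂ c.e (φ • D.U k c.t c.jet.R)) =O[⊤] err :=
  isBigO_mono (isBigO_inner φ isBigO_e isBigO_R) fun c => by
    have := c.h_pos
    rw [abs_of_nonneg (by positivity), mul_one_div]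
    exact c.norm_e_div_le

theorem isBigO_inner_R_e (φ : Per) :
    (fun c : Cfg D k => inner ℂ c.jet.R (φ • D.U k c.t c.e)) =O[⊤] err :=
  isBigO_mono (isBigO_inner φ isBigO_R isBigO_e) fun c => by
    have := c.h_pos
    rw [abs_of_nonneg (by positivity), one_div_mul_eq_div]
    exact c.norm_e_div_le

theorem isBigO_inner_e_u (φ : Per) :
    (fun c : Cfg D k => inner ℂ c.e (φ • D.U k c.t c.u)) =O[⊤] err :=
  isBigO_mono (isBigO_inner φ isBigO_e isBigO_u) fun c => by
    rw [mul_one, abs_of_nonneg (norm_nonneg _)]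
    exact c.norm_e_le

/-- Multiplication by a factor at most one. -/
theorem isBigO_t_mul {F : Cfg D k → ℂ} (hF : F =O[⊤] f) (hf : ∀ c, 0 ≤ f c) :
    (fun c => (c.t : ℂ) * F c) =O[⊤] f :=
  isBigO_mono (isBigO_real_mul (fun c => c.t) hF) fun c => by
    rw [abs_of_nonneg (mul_nonneg c.t_nonneg (hf c))]
    exact mul_le_of_le_one_left (hf c) c.t_le

theorem isBigO_hsq_mul {F : Cfg D k → ℂ} (hF : F =O[⊤] f) :
    (fun c => (c.h : ℂ) ^ 2 * F c) =O[⊤] fun c => c.h ^ 2 * f c :=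
  (isBigO_real_mul (fun c => c.h ^ 2) hF).congr_left fun c => by push_cast; rfl

theorem isBigO_hsq_left (φ : Per) {x y : Cfg D k → Sec D.B0} (hx : x =O[⊤] fun c => 1 / c.h)
    (hy : y =O[⊤] fun _ => (1 : ℝ)) :
    (fun c => (c.h : ℂ) ^ 2 * inner ℂ (x c) (φ • D.U k c.t (y c))) =O[⊤] err :=
  isBigO_mono (isBigO_hsq_mul (isBigO_inner φ hx hy)) fun c => by
    have := c.h_pos
    rw [abs_of_nonneg (by positivity), show c.h ^ 2 * (1 / c.h * 1) = c.h by field_simp]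
    exact c.h_le_err

theorem isBigO_hsq_right (φ : Per) {x y : Cfg D k → Sec D.B0} (hx : x =O[⊤] fun _ => (1 : ℝ))
    (hy : y =O[⊤] fun c => 1 / c.h) :
    (fun c => (c.h : ℂ) ^ 2 * inner ℂ (x c) (φ • D.U k c.t (y c))) =O[⊤] err :=
  isBigO_mono (isBigO_hsq_mul (isBigO_inner φ hx hy)) fun c => by
    have := c.h_pos
    rw [abs_of_nonneg (by positivity), show c.h ^ 2 * (1 * (1 / c.h)) = c.h by field_simp]
    exact c.h_le_err

theorem isBigO_hsq_bet (φ : Per) :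
    (fun c => (c.h : ℂ) ^ 2 * inner ℂ c.jet.R (φ • D.bet k c.t • D.U k c.t c.u)) =O[⊤]
      (err : Cfg D k → ℝ) :=
  isBigO_mono (isBigO_hsq_mul (isBigO_inner_bet φ isBigO_R isBigO_u)) fun c => by
    have := c.h_pos
    have := c.t_nonneg
    rw [abs_of_nonneg (by positivity),
      show c.h ^ 2 * (c.t * (1 / c.h * 1)) = c.t * c.h by field_simp]
    exact (mul_le_of_le_one_left c.h_pos.le c.t_le).trans c.h_le_err

theorem isBigO_hsq_energy (φ φk φp : Per) :
    (fun c : Cfg D k => nsq k * inner ℂ c.e (φ • D.U k c.t c.u) + (c.h : ℂ) ^ 2 *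
      (Complex.I * inner ℂ c.jet.P (φk • D.U k c.t c.u) -
        nsq k * inner ℂ c.jet.R (φ • D.bet k c.t • D.U k c.t c.u) +
        Complex.I * inner ℂ c.jet.R (φp • D.U k c.t c.u))) =O[⊤] err := by
  have h1 := (isBigO_inner_e_u (k := k) (D := D) φ).const_mul_left (nsq k : ℂ)
  have h2 := (isBigO_hsq_left φk (isBigO_P (D := D) (k := k)) isBigO_u).const_mul_left Complex.I
  have h3 := (isBigO_hsq_bet (D := D) (k := k) φ).const_mul_left (nsq k : ℂ)
  have h4 := (isBigO_hsq_left φp (isBigO_R (D := D) (k := k)) isBigO_u).const_mul_left Complex.I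
  refine (((h1.add h2).sub h3).add h4).congr_left fun c => ?_
  ring

theorem isBigO_field {Bk Bpp : Per} (hk : PerD k D.Bp Bk) (hp : PerD (perp k) D.Bp Bpp)
    (hK : nsq k ≠ 0) :
    (fun c : Cfg D k => (c.t : ℂ) * (nsq k * inner ℂ c.u (D.Bp • D.U k c.t c.u) -
      (c.h : ℂ) ^ 2 * inner ℂ c.jet.P (D.Bp • D.U k c.t c.jet.P))) =O[⊤] err := by
  have a1 := isBigO_inner_e_R (D := D) (k := k) 1
  have a2 := isBigO_inner_R_e (D := D) (k := k) 1
  have d0 : _ =O[⊤] err := isBigO_mono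
    ((isBigO_inner_bet_sub (isBigO_u (D := D) (k := k)) isBigO_u).const_mul_left (nsq k : ℂ))
    fun c => by
      rw [mul_one, mul_one, abs_of_nonneg (sq_nonneg _)]
      exact c.t_sq_le_err
  have hd : ∀ c : Cfg D k, |c.h ^ 2 * (c.t ^ 2 * (1 / c.h * (1 / c.h)))| ≤ c.err := fun c => by
    have := c.h_pos
    rw [show c.h ^ 2 * (c.t ^ 2 * (1 / c.h * (1 / c.h))) = c.t ^ 2 by field_simp,
      abs_of_nonneg (sq_nonneg _)]
    exact c.t_sq_le_err
  have dP := isBigO_mono (isBigO_hsq_mul (isBigO_inner_bet_sub (isBigO_P (D := D) (k := k))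
    isBigO_P)) hd
  have dR := isBigO_mono (isBigO_hsq_mul (isBigO_inner_bet_sub (isBigO_R (D := D) (k := k))
    isBigO_R)) hd
  have q1 := (isBigO_hsq_left 1 (isBigO_P (D := D) (k := k)) isBigO_Bu).const_mul_left Complex.I
  have q2 := (isBigO_hsq_right 1 (isBigO_Bu (D := D) (k := k)) isBigO_P).const_mul_left Complex.I
  have b := isBigO_t_mul (isBigO_hsq_energy (D := D) (k := k) D.Bp Bk Bpp) err_nonneg
  refine (((((((a1.sub a2).sub d0).add dP).sub dR).sub q1).sub q2).sub b).const_mul_left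
    (1 / 2 : ℂ) |>.congr_left fun c => ?_
  have hKC : (nsq k : ℂ) ≠ 0 := by exact_mod_cast hK
  have i1 := c.jet.commutator_deriv (perD_one k) (perD_one (perp k)) c.t
  have i2 := c.jet.energy hk hp c.t
  simp only [one_smul, zero_smul, inner_zero_right] at i1 ⊢
  refine mul_left_cancel₀ hKC ?_
  linear_combination (-1 / 2 : ℂ) * i1 - (nsq k * c.t / 2 : ℂ) * i2

theorem isBigO_cutoff {ψ ψk ψp ψpk ψpp : Per} (hk : PerD k ψ ψk) (hp : PerD (perp k) ψ ψp)
    (hpk : PerD k ψp ψpk) (hpp : PerD (perp k) ψp ψpp) :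
    (fun c : Cfg D k => (2 : ℂ) * nsq k * inner ℂ c.u (ψp • D.U k c.t c.u) -
      2 * (c.h : ℂ) ^ 2 * inner ℂ c.jet.P (ψp • D.U k c.t c.jet.P) +
      (c.h : ℂ) ^ 2 * (inner ℂ c.jet.P (ψk • D.U k c.t c.jet.R) +
        inner ℂ c.jet.R (ψk • D.U k c.t c.jet.P))) =O[⊤] fun c => c.err + c.t := by
  have he : ∀ c : Cfg D k, |c.err| ≤ c.err + c.t := fun c => by
    rw [abs_of_nonneg c.err_nonneg]; linarith [c.t_nonneg]
  have a1 := (isBigO_mono (isBigO_inner_e_R (D := D) (k := k) ψ) he).const_mul_left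
    (Complex.I * nsq k)
  have a2 := (isBigO_mono (isBigO_inner_R_e (D := D) (k := k) ψ) he).const_mul_left
    (Complex.I * nsq k)
  have ht : ∀ c : Cfg D k, |c.t| ≤ c.err + c.t := fun c => by
    rw [abs_of_nonneg c.t_nonneg]; linarith [c.err_nonneg]
  have d0 := (isBigO_mono (isBigO_inner_bet ψ (isBigO_u (D := D) (k := k)) isBigO_u)
    (g := fun c => c.err + c.t) fun c => by rw [mul_one, mul_one]; exact ht c).const_mul_left (Complex.I * nsq k ^ 2)
  have hd : ∀ c : Cfg D k, |c.h ^ 2 * (c.t * (1 / c.h * (1 / c.h)))| ≤ c.err + c.t := fun c => by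
    have := c.h_pos
    rw [show c.h ^ 2 * (c.t * (1 / c.h * (1 / c.h))) = c.t by field_simp]
    exact ht c
  have dP := (isBigO_mono (isBigO_hsq_mul (isBigO_inner_bet ψ (isBigO_P (D := D) (k := k))
    isBigO_P)) hd).const_mul_left (Complex.I * nsq k)
  have dR := (isBigO_mono (isBigO_hsq_mul (isBigO_inner_bet ψ (isBigO_R (D := D) (k := k))
    isBigO_R)) hd).const_mul_left (Complex.I * nsq k)
  have q1 := (isBigO_mono (isBigO_hsq_left ψ (isBigO_P (D := D) (k := k)) isBigO_Bu)
    he).const_mul_left (nsq k : ℂ)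
  have q2 := (isBigO_mono (isBigO_hsq_right ψ (isBigO_Bu (D := D) (k := k)) isBigO_P)
    he).const_mul_left (nsq k : ℂ)
  have b := isBigO_mono (isBigO_hsq_energy (D := D) (k := k) ψp ψpk ψpp) he
  refine (((((((a1.sub a2).sub d0).add dP).sub dR).add q1).add q2).sub b).congr_left fun c => ?_
  have i1 := c.jet.commutator_deriv hk hp c.t
  have i2 := c.jet.energy hpk hpp c.t
  linear_combination -Complex.I * i1 - i2 + ((c.h : ℂ) ^ 2 * (nsq k *
    (inner ℂ c.jet.P (ψ • D.U k c.t (D.Bp • c.u)) + inner ℂ (D.Bp • c.u) (ψ • D.U k c.t c.jet.P)) -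
    inner ℂ c.jet.P (ψk • D.U k c.t c.jet.R) - inner ℂ c.jet.R (ψk • D.U k c.t c.jet.P) +
    inner ℂ c.jet.P (ψp • D.U k c.t c.jet.P) - inner ℂ c.jet.R (ψp • D.U k c.t c.jet.R)) -
    nsq k * inner ℂ c.u (ψp • D.U k c.t c.u)) * Complex.I_sq

/-- The main estimate: averaging the transported quasimode against a function cohomologous to the
magnetic field in the direction `k^⊥`. -/
theorem isBigO_averaged_field {ψ ψk ψp ψpk ψpp b Bk Bpp : Per} (hK : nsq k ≠ 0)
    (hk : PerD k ψ ψk) (hp : PerD (perp k) ψ ψp)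
    (hpk : PerD k ψp ψpk) (hpp : PerD (perp k) ψp ψpp)
    (hBk : PerD k D.Bp Bk) (hBp : PerD (perp k) D.Bp Bpp) (hb : D.Bp = b + ψp) :
    (fun c : Cfg D k => (c.t : ℂ) * (nsq k * inner ℂ c.u (b • D.U k c.t c.u) -
      (c.h : ℂ) ^ 2 * (inner ℂ c.jet.P (b • D.U k c.t c.jet.P) +
        1 / 2 * (inner ℂ c.jet.P (ψk • D.U k c.t c.jet.R) +
        inner ℂ c.jet.R (ψk • D.U k c.t c.jet.P))))) =O[⊤] err := by
  have h1 := isBigO_field (D := D) (k := k) hBk hBp hK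
  have h2 := (isBigO_mono (isBigO_real_mul (fun c => c.t)
    (isBigO_cutoff (D := D) (k := k) hk hp hpk hpp)) (g := fun c => 2 * c.err) fun c => by
      have := c.t_nonneg
      have := c.err_nonneg
      rw [abs_of_nonneg (by positivity)]
      nlinarith [c.t_sq_le_err, c.t_le]).trans
        ((isBigO_refl err (⊤ : Filter (Cfg D k))).const_mul_left 2)
  refine (h1.sub (h2.const_mul_left (1 / 2 : ℂ))).congr_left fun c => ?_
  rw [hb]
  simp only [add_smul, inner_add_right]
  ring

end Cfg

end MagData

end Claims

section TimeIntegral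

open Asymptotics

namespace MagData

variable {D : MagData} {k : Pt}

theorem norm_inner_smul_U_le (x y : Sec D.B0) (φ : Per) (t : ℝ) :
    ‖inner ℂ x (φ • D.U k t y)‖ ≤ perBd φ * (‖x‖ * ‖y‖) := by
  have := Sec.norm_inner_smul_le_of_bound (norm_le_perBd φ) x (D.U k t y)
  rwa [norm_U, mul_assoc] at this

theorem norm_integral_inner_smul_U_le {x y : Sec D.B0} {φ : Per} {r T : ℝ} (hrT : r ≤ T) :
    ‖∫ t in r..T, inner ℂ x (φ • D.U k t y)‖ ≤ perBd φ * (‖x‖ * ‖y‖) * (T - r) := by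
  have := intervalIntegral.norm_integral_le_of_norm_le_const (a := r) (b := T)
    (f := fun t => inner ℂ x (φ • D.U k t y)) fun t _ => norm_inner_smul_U_le x y φ t
  rwa [abs_of_nonneg (sub_nonneg.2 hrT)] at this

theorem DD.norm_integral_right_le {y y' : Sec D.B0} (hy : D.DD k y y') (z : Sec D.B0) (φ : Per)
    (r T : ℝ) : ‖∫ t in r..T, inner ℂ z (φ • D.U k t y')‖ ≤ 2 * (perBd φ * (‖z‖ * ‖y‖)) := by
  rw [hy.integral_inner_smul_U, norm_mul, norm_neg, Complex.norm_I, one_mul]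
  refine (norm_sub_le _ _).trans ?_
  linarith [norm_inner_smul_U_le (k := k) z y φ T, norm_inner_smul_U_le (k := k) z y φ r]

theorem DD.norm_integral_left_le {x x' y y' : Sec D.B0} {φ φd : Per} (hx : D.DD k x x')
    (hy : D.DD k y y') (hφ : PerD k φ φd) {r T : ℝ} (hrT : r ≤ T) (hT : T - r ≤ 1) :
    ‖∫ t in r..T, inner ℂ x' (φ • D.U k t y)‖ ≤ (2 * perBd φ + perBd φd) * (‖x‖ * ‖y‖) := by
  simp only [hx.inner_smul_U_self hy hφ]
  rw [intervalIntegral.integral_sub ((D.continuous_inner_smul_U k _ _ _).intervalIntegrable _ _)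
    (((D.continuous_inner_smul_U k _ _ _).const_mul _).intervalIntegrable _ _),
    intervalIntegral.integral_const_mul]
  refine (norm_sub_le _ _).trans ?_
  rw [norm_mul, Complex.norm_I, one_mul]
  have h1 := hy.norm_integral_right_le x φ r T
  have h2 := norm_integral_inner_smul_U_le (k := k) (x := x) (y := y) (φ := φd) hrT
  have h3 : perBd φd * (‖x‖ * ‖y‖) * (T - r) ≤ perBd φd * (‖x‖ * ‖y‖) * 1 :=
    mul_le_mul_of_nonneg_left hT
      (mul_nonneg (perBd_nonneg _) (mul_nonneg (norm_nonneg _) (norm_nonneg _)))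
  linarith

namespace Cfg

/-- The same quasimode at another transport time. -/
def setTime (c : Cfg D k) (s : ℝ) (hs : 0 ≤ s) (hsT : s ≤ c.t) : Cfg D k :=
  { c with
    t := s
    t_nonneg := hs
    t_sq := (pow_le_pow_left₀ hs hsT 2).trans c.t_sq }

theorem exists_norm_P_R_le (D : MagData) (k : Pt) :
    ∃ C, 0 ≤ C ∧ ∀ c : Cfg D k, ‖c.jet.P‖ ≤ C / c.h ∧ ‖c.jet.R‖ ≤ C / c.h := by
  obtain ⟨C₁, h₁⟩ := isBigO_top.1 (isBigO_P (D := D) (k := k))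
  obtain ⟨C₂, h₂⟩ := isBigO_top.1 (isBigO_R (D := D) (k := k))
  refine ⟨max 0 (max C₁ C₂), le_max_left _ _, fun c => ?_⟩
  have hp : 0 ≤ 1 / c.h := (one_div_pos.2 c.h_pos).le
  constructor
  · refine (h₁ c).trans ?_
    rw [Real.norm_of_nonneg hp, div_eq_mul_one_div (max _ _)]
    exact mul_le_mul_of_nonneg_right ((le_max_left _ _).trans (le_max_right _ _)) hp
  · refine (h₂ c).trans ?_
    rw [Real.norm_of_nonneg hp, div_eq_mul_one_div (max _ _)]
    exact mul_le_mul_of_nonneg_right ((le_max_right _ _).trans (le_max_right _ _)) hp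

/-- The terms of the main estimate which are integrated in time. -/
def flux (c : Cfg D k) (b ψk : Per) (s : ℝ) : ℂ :=
  inner ℂ c.jet.P (b • D.U k s c.jet.P) +
    1 / 2 * (inner ℂ c.jet.P (ψk • D.U k s c.jet.R) + inner ℂ c.jet.R (ψk • D.U k s c.jet.P))

theorem continuous_flux (c : Cfg D k) (b ψk : Per) : Continuous (c.flux b ψk) :=
  (D.continuous_inner_smul_U k _ _ _).add (continuous_const.mul
    ((D.continuous_inner_smul_U k _ _ _).add (D.continuous_inner_smul_U k _ _ _)))

theorem exists_norm_integral_flux_le (D : MagData) (k : Pt) (b : Per) {ψk ψkk : Per}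
    (hkk : PerD k ψk ψkk) :
    ∃ C, 0 ≤ C ∧ ∀ (c : Cfg D k) (r : ℝ), 0 ≤ r → r ≤ c.t →
      ‖∫ s in r..c.t, c.flux b ψk s‖ ≤ C / c.h := by
  obtain ⟨C, hC, hPR⟩ := exists_norm_P_R_le D k
  have hb := perBd_nonneg b
  have hψ := perBd_nonneg ψk
  have hψk := perBd_nonneg ψkk
  refine ⟨(2 * perBd b + (2 * perBd ψk + perBd ψkk) + 2 * perBd ψk) * C,
    by positivity, fun c r hr hrT => ?_⟩
  obtain ⟨hP, hR⟩ := hPR c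
  have h1 := c.jet.hP.norm_integral_right_le c.jet.P b r c.t
  have h2 := c.jet.hP.norm_integral_left_le c.jet.hPR hkk hrT (by linarith [c.t_le])
  have h3 := c.jet.hP.norm_integral_right_le c.jet.R ψk r c.t
  rw [c.norm_u] at h1 h2 h3
  have i1 := fun x y φ => (D.continuous_inner_smul_U k x y φ).intervalIntegrable (μ := volume) r c.t
  unfold flux
  rw [intervalIntegral.integral_add (i1 _ _ _) (((i1 _ _ _).add (i1 _ _ _)).const_mul _),
    intervalIntegral.integral_const_mul, intervalIntegral.integral_add (i1 _ _ _) (i1 _ _ _)]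
  refine (norm_add_le _ _).trans ?_
  rw [norm_mul]
  have h4 := norm_add_le (∫ s in r..c.t, inner ℂ c.jet.P (ψk • D.U k s c.jet.R))
    (∫ s in r..c.t, inner ℂ c.jet.R (ψk • D.U k s c.jet.P))
  have h5 : ‖(1 / 2 : ℂ)‖ = 1 / 2 := by simp
  rw [h5, mul_div_assoc]
  nlinarith [mul_le_mul_of_nonneg_left hP hb, mul_le_mul_of_nonneg_left hR hψ,
    mul_le_mul_of_nonneg_left hR hψk, norm_nonneg c.jet.R, mul_nonneg hψ (norm_nonneg c.jet.R),
    mul_nonneg hψk (norm_nonneg c.jet.R),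
    norm_nonneg (∫ s in r..c.t, inner ℂ c.jet.P (ψk • D.U k s c.jet.R)),
    norm_nonneg (∫ s in r..c.t, inner ℂ c.jet.R (ψk • D.U k s c.jet.P))]

variable {ψ ψk ψp ψpk ψpp b Bk Bpp ψkk : Per}

theorem exists_norm_integral_le (hK : 0 < nsq k)
    (hk : PerD k ψ ψk) (hp : PerD (perp k) ψ ψp) (hkk : PerD k ψk ψkk)
    (hpk : PerD k ψp ψpk) (hpp : PerD (perp k) ψp ψpp)
    (hBk : PerD k D.Bp Bk) (hBp : PerD (perp k) D.Bp Bpp) (hb : D.Bp = b + ψp) :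
    ∃ C, 0 ≤ C ∧ ∀ (c : Cfg D k) (r : ℝ), 0 < r → r ≤ c.t →
      ‖∫ s in r..c.t, inner ℂ c.u (b • D.U k s c.u)‖ ≤ C * (c.h + c.t * c.err / r) := by
  obtain ⟨C₁, hC₁, h₁⟩ := exists_norm_integral_flux_le D k b hkk
  obtain ⟨C₂, h₂⟩ := isBigO_top.1
    (isBigO_averaged_field (D := D) (k := k) hK.ne' hk hp hpk hpp hBk hBp hb)
  refine ⟨max C₁ C₂ / nsq k, div_nonneg (hC₁.trans (le_max_left _ _)) hK.le,
    fun c r hr hrT => ?_⟩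
  have hM : 0 ≤ max C₁ C₂ := hC₁.trans (le_max_left _ _)
  have hh := c.h_pos
  have he := c.err_nonneg
  set g : ℝ → ℂ := fun s => inner ℂ c.u (b • D.U k s c.u) with hg
  have hgc : Continuous g := D.continuous_inner_smul_U k _ _ _
  have hfc := c.continuous_flux b ψk
  have pt : ∀ s ∈ Set.uIoc r c.t, ‖(nsq k : ℂ) * g s - (c.h : ℂ) ^ 2 * c.flux b ψk s‖ ≤
      max C₁ C₂ * c.err / r := fun s hs => by
    rw [Set.uIoc_of_le hrT] at hs
    have hs0 : 0 < s := hr.trans hs.1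
    have := h₂ (c.setTime s hs0.le hs.2)
    rw [norm_mul] at this
    change ‖(s : ℂ)‖ * ‖(nsq k : ℂ) * g s - (c.h : ℂ) ^ 2 * c.flux b ψk s‖ ≤ C₂ * ‖c.err‖ at this
    rw [Complex.norm_real, Real.norm_of_nonneg hs0.le, Real.norm_of_nonneg he] at this
    rw [le_div_iff₀ hr, mul_comm]
    refine (mul_le_mul_of_nonneg_right hs.1.le (norm_nonneg _)).trans (this.trans ?_)
    exact mul_le_mul_of_nonneg_right (le_max_right _ _) he
  have e1 := intervalIntegral.norm_integral_le_of_norm_le_const pt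
  rw [intervalIntegral.integral_sub ((hgc.const_mul _).intervalIntegrable _ _)
    ((hfc.const_mul _).intervalIntegrable _ _), intervalIntegral.integral_const_mul,
    intervalIntegral.integral_const_mul, abs_of_nonneg (sub_nonneg.2 hrT)] at e1
  have e2 : ‖(c.h : ℂ) ^ 2 * ∫ s in r..c.t, c.flux b ψk s‖ ≤ max C₁ C₂ * c.h := by
    rw [norm_mul, norm_pow, Complex.norm_real, Real.norm_of_nonneg hh.le]
    calc c.h ^ 2 * ‖∫ s in r..c.t, c.flux b ψk s‖ ≤ c.h ^ 2 * (C₁ / c.h) :=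
          mul_le_mul_of_nonneg_left (h₁ c r hr.le hrT) (by positivity)
      _ = C₁ * c.h := by field_simp
      _ ≤ _ := mul_le_mul_of_nonneg_right (le_max_left _ _) hh.le
  have e3 : nsq k * ‖∫ s in r..c.t, g s‖ = ‖(nsq k : ℂ) * ∫ s in r..c.t, g s‖ := by
    rw [norm_mul, Complex.norm_real, Real.norm_of_nonneg hK.le]
  have e4 : max C₁ C₂ * c.err / r * (c.t - r) ≤ max C₁ C₂ * (c.t * c.err / r) := by
    calc max C₁ C₂ * c.err / r * (c.t - r) ≤ max C₁ C₂ * c.err / r * c.t :=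
          mul_le_mul_of_nonneg_left (by linarith) (by positivity)
      _ = _ := by ring
  have e5 := norm_add_le ((nsq k : ℂ) * (∫ s in r..c.t, g s) -
    (c.h : ℂ) ^ 2 * ∫ s in r..c.t, c.flux b ψk s) ((c.h : ℂ) ^ 2 * ∫ s in r..c.t, c.flux b ψk s)
  rw [sub_add_cancel, ← e3] at e5
  rw [div_mul_eq_mul_div, le_div_iff₀ hK]
  linarith

/-- Cancellation in time of the correlations weighted by the averaged field. -/
theorem exists_norm_integral_le_sqrt (hK : 0 < nsq k)
    (hk : PerD k ψ ψk) (hp : PerD (perp k) ψ ψp) (hkk : PerD k ψk ψkk)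
    (hpk : PerD k ψp ψpk) (hpp : PerD (perp k) ψp ψpp)
    (hBk : PerD k D.Bp Bk) (hBp : PerD (perp k) D.Bp Bpp) (hb : D.Bp = b + ψp) :
    ∃ C, 0 ≤ C ∧ ∀ (c : Cfg D k) (s η : ℝ), 0 < s → s ^ 2 = c.h → 0 < η → s ≤ η →
      c.err ≤ η ^ 2 * s →
      ‖∫ t in (0 : ℝ)..c.t, inner ℂ c.u (b • D.U k t c.u)‖ ≤ C * (s * η) := by
  obtain ⟨C, hC, hi⟩ := exists_norm_integral_le (D := D) hK hk hp hkk hpk hpp hBk hBp hb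
  have hb0 := perBd_nonneg b
  refine ⟨2 * C + perBd b, by positivity, fun c s η hs hsh hη hsη herr => ?_⟩
  have ht0 := c.t_nonneg
  have hts : c.t ≤ s := (abs_le_of_sq_le_sq' (by rw [hsh]; exact c.t_sq) hs.le).2
  have small : ∀ r, 0 ≤ r → ‖∫ t in (0 : ℝ)..r, inner ℂ c.u (b • D.U k t c.u)‖ ≤ perBd b * r :=
    fun r hr => by
      have := norm_integral_inner_smul_U_le (k := k) (x := c.u) (y := c.u) (φ := b) hr
      simpa [c.norm_u] using this
  rcases le_or_gt c.t (s * η) with hle | hlt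
  · refine (small _ ht0).trans ?_
    have := mul_le_mul_of_nonneg_left hle hb0
    have : 0 ≤ 2 * C * (s * η) := by positivity
    linarith
  · have hr : 0 < s * η := by positivity
    have ii := fun p q => (D.continuous_inner_smul_U k c.u c.u b).intervalIntegrable
      (μ := volume) p q
    rw [← intervalIntegral.integral_add_adjacent_intervals (ii 0 (s * η)) (ii (s * η) c.t)]
    refine (norm_add_le _ _).trans ?_
    have h1 := hi c (s * η) hr hlt.le
    have h2 : c.h ≤ s * η := by rw [← hsh, sq]; exact mul_le_mul_of_nonneg_left hsη hs.le
    have h3 : c.t * c.err / (s * η) ≤ s * η := by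
      rw [div_le_iff₀ hr]
      calc c.t * c.err ≤ s * (η ^ 2 * s) :=
            mul_le_mul hts herr c.err_nonneg hs.le
        _ = s * η * (s * η) := by ring
    have h4 := mul_le_mul_of_nonneg_left (add_le_add h2 h3) hC
    linarith [small _ hr.le]

end Cfg

end MagData

end TimeIntegral

section AveragedField

theorem PerD.contDiff_one {d : Pt} {φ φd : Per} (h : PerD d φ φd) (hφ : ContDiff ℝ 2 φ.1) :
    ContDiff ℝ 1 φd.1 := by
  have h1 : ContDiff ℝ 1 (fderiv ℝ φ.1) := hφ.fderiv_right (by norm_num)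
  have h2 : φd.1 = fun x => fderiv ℝ φ.1 x d := funext h.2
  rw [h2]
  exact h1.clm_apply contDiff_const

namespace MagData

theorem perp_lat (m : ℤ × ℤ) : perp (lat m) = lat (-m.2, m.1) := by
  simp [perp, lat]

theorem nsq_lat_pos {m : ℤ × ℤ} (hm : m ≠ 0) : 0 < nsq (lat m) := by
  have h : (m.1 : ℝ) ≠ 0 ∨ (m.2 : ℝ) ≠ 0 := by
    by_contra! hc
    exact hm (Prod.ext (by exact_mod_cast hc.1) (by exact_mod_cast hc.2))
  simp only [nsq, dotp, lat]
  rcases h with h | h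
  · nlinarith [mul_self_pos.2 h, mul_self_nonneg (m.2 : ℝ)]
  · nlinarith [mul_self_pos.2 h, mul_self_nonneg (m.1 : ℝ)]

theorem periodic_comp_line_lat {g : Pt → ℝ} (hg : IsPeriodic g) (m : ℤ × ℤ) (x : Pt) :
    Function.Periodic (fun τ : ℝ => g (x + τ • lat m)) 1 := fun τ => by
  change g (x + (τ + 1) • lat m) = g (x + τ • lat m)
  rw [add_smul, one_smul, ← add_assoc]
  exact hg m _

/-- The directional average along a rational direction is the average over a closed orbit. -/
theorem lineInt_lat_eq_of_tendsto {g : Pt → ℝ} (hc : Continuous g) (hg : IsPeriodic g)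
    (m : ℤ × ℤ) {ℓ : ℝ} (hℓ : 0 < ℓ) (x : Pt) {L : ℝ}
    (hL : Tendsto (fun T : ℝ => (1 / T) * ∫ t in (0 : ℝ)..T, g (x + t • (ℓ⁻¹ • lat m)))
      atTop (𝓝 L)) : lineInt (lat m) g 1 x = L := by
  have hT : Tendsto (fun N : ℕ => ((N : ℝ) + 1) * ℓ) atTop atTop :=
    (tendsto_atTop_add_const_right _ 1 tendsto_natCast_atTop_atTop).atTop_mul_const hℓ
  refine tendsto_nhds_unique (tendsto_const_nhds.congr fun N => ?_) (hL.comp hT)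
  have h1 := (periodic_comp_line_lat hg m x).intervalIntegral_add_zsmul_eq (N + 1) 0
    fun _ _ => Continuous.intervalIntegrable (by fun_prop) _ _
  have h2 := intervalIntegral.inv_mul_integral_comp_div (f := fun τ => g (x + τ • lat m))
    (a := 0) (b := ((N : ℝ) + 1) * ℓ) (c := ℓ)
  have h3 : (0 : ℝ) < (N : ℝ) + 1 := by positivity
  simp only [zero_add, zsmul_eq_mul, mul_one, zero_div, mul_div_assoc, div_self hℓ.ne'] at h1 h2
  simp only [Function.comp, smul_smul, lineInt, ← div_eq_mul_inv]
  push_cast at h1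
  rw [h1] at h2
  have h4 : ∫ t in (0 : ℝ)..((N : ℝ) + 1) * ℓ, g (x + (t / ℓ) • lat m) =
      ℓ * (((N : ℝ) + 1) * ∫ τ in (0 : ℝ)..1, g (x + τ • lat m)) := by
    rw [← h2, ← mul_assoc, mul_inv_cancel₀ hℓ.ne', one_mul]
  rw [h4]
  field_simp

variable (D : MagData)

/-- The average of the magnetic field over closed orbits in the direction `k`. -/
def fieldAvg (k : Pt) : Per :=
  Per.ofReal (lineInt k D.B 1) (continuous_lineInt_right k D.contDiff_B.continuous 1)
    (D.isPeriodic_B.lineInt k 1)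

theorem contDiff_fieldAvg (k : Pt) (n : ℕ) : ContDiff ℝ n (D.fieldAvg k).1 :=
  Complex.ofRealCLM.contDiff.comp
    (contDiff_lineInt k (D.contDiff_B.of_le (by exact_mod_cast le_top)) 1)

theorem exists_fieldAvg_lower_bound {k : Pt} (hB : ∀ x, 0 < lineInt k D.B 1 x) :
    ∃ c, 0 < c ∧ ∀ x, c ≤ lineInt k D.B 1 x := by
  have hc := continuous_lineInt_right k D.contDiff_B.continuous 1
  obtain ⟨y, -, hy⟩ := isCompact_fund.exists_isMinOn
    ⟨0, by simp [fund, ← Prod.mk_zero_zero]⟩ hc.continuousOn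
  refine ⟨_, hB y, fun x => ?_⟩
  have h := (D.isPeriodic_B.lineInt k 1) (⌊x.1⌋, ⌊x.2⌋) (Int.fract x.1, Int.fract x.2)
  simp only [Int.fract_add_floor] at h
  rw [Prod.mk.eta] at h
  rw [h]
  exact hy ⟨⟨Int.fract_nonneg _, Int.fract_nonneg _⟩,
    ⟨(Int.fract_lt_one _).le, (Int.fract_lt_one _).le⟩⟩

/-- The magnetic field and its average along closed orbits differ by a directional derivative. -/
theorem exists_fieldAvg_primitive (m : ℤ × ℤ) :
    ∃ ψ ψp : Per, ContDiff ℝ 2 ψ.1 ∧ ContDiff ℝ 1 ψp.1 ∧ PerD (lat m) ψ ψp ∧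
      D.Bp = D.fieldAvg (lat m) + ψp := by
  have hB1 : ContDiff ℝ 1 D.B := D.contDiff_B.of_le (by exact_mod_cast le_top)
  have hB2 : ContDiff ℝ 2 D.B := D.contDiff_B.of_le (WithTop.coe_le_coe.2 le_top)
  have hs : ContDiff ℝ 2 fun x => ∫ τ in (0 : ℝ)..1, τ * D.B (x + τ • lat m) := by
    refine contDiff_parametric_intervalIntegral 2 ?_ 0 1
    simp only [Function.uncurry_def]
    fun_prop
  have hper : IsPeriodic fun x => ∫ τ in (0 : ℝ)..1, τ * D.B (x + τ • lat m) := fun n x =>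
    intervalIntegral.integral_congr fun τ _ =>
      congrArg (τ * ·) (D.isPeriodic_B.comp_add (τ • lat m) n x)
  let ψ : Per := Per.ofReal _ hs.continuous hper
  have hψ : ContDiff ℝ 2 ψ.1 := Complex.ofRealCLM.contDiff.comp hs
  refine ⟨ψ, D.Bp - D.fieldAvg (lat m), hψ, (contDiff_Bp 1).sub (D.contDiff_fieldAvg _ 1),
    ⟨hψ.of_le (by norm_num), fun x => ?_⟩, by abel⟩
  obtain ⟨L, h1, h2⟩ := hasFDerivAt_weighted_lineInt (lat m) (w := fun τ => τ) contDiff_id hB1 0 1 x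
  have h3 : HasFDerivAt ψ.1 (Complex.ofRealCLM.comp L) x :=
    Complex.ofRealCLM.hasFDerivAt.comp x h1
  have h4 := intervalIntegral.integral_mul_deriv_eq_deriv_mul (a := 0) (b := 1) (u := fun τ : ℝ => τ)
    (u' := fun _ => 1) (v := fun τ => D.B (x + τ • lat m))
    (v' := fun τ => fderiv ℝ D.B (x + τ • lat m) (lat m))
    (fun τ _ => hasDerivAt_id τ) (fun τ _ => hasDerivAt_comp_line hB1 _ x τ)
    intervalIntegrable_const (Continuous.intervalIntegrable (by
      have := hB1.continuous_fderiv (by simp)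
      fun_prop) 0 1)
  have h5 : D.B (x + lat m) = D.B x := D.isPeriodic_B m x
  rw [h3.fderiv, ContinuousLinearMap.comp_apply, h2, h4]
  simp only [one_smul, one_mul, zero_mul, sub_zero, h5]
  change ((D.B x : ℂ)) - ((lineInt (lat m) D.B 1 x : ℝ) : ℂ) = _
  rw [lineInt, Complex.ofRealCLM_apply]
  push_cast
  rfl

variable {D}

/-- Cancellation in time of the correlations weighted by the averaged field, for rational
directions. -/
theorem exists_norm_integral_fieldAvg_le (D : MagData) {m : ℤ × ℤ} (hm : m ≠ 0) :
    ∃ C, 0 ≤ C ∧ ∀ (c : Cfg D (lat m)) (s η : ℝ), 0 < s → s ^ 2 = c.h → 0 < η → s ≤ η →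
      c.err ≤ η ^ 2 * s →
      ‖∫ t in (0 : ℝ)..c.t, inner ℂ c.u (D.fieldAvg (perp (lat m)) • D.U (lat m) t c.u)‖ ≤
        C * (s * η) := by
  obtain ⟨ψ, ψp, hψ, hψp, hp, hb⟩ := D.exists_fieldAvg_primitive (-m.2, m.1)
  rw [← perp_lat] at hp hb
  obtain ⟨ψk, hk⟩ := exists_perD ψ (hψ.of_le (by norm_num)) (lat m)
  obtain ⟨ψkk, hkk⟩ := exists_perD ψk (hk.contDiff_one hψ) (lat m)
  obtain ⟨ψpk, hpk⟩ := exists_perD ψp hψp (lat m)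
  obtain ⟨ψpp, hpp⟩ := exists_perD ψp hψp (perp (lat m))
  obtain ⟨Bk, hBk⟩ := exists_perD D.Bp (contDiff_Bp 1) (lat m)
  obtain ⟨Bpp, hBp⟩ := exists_perD D.Bp (contDiff_Bp 1) (perp (lat m))
  exact Cfg.exists_norm_integral_le_sqrt (nsq_lat_pos hm) hk hp hkk hpk hpp hBk hBp hb

end MagData

end AveragedField

section Positivity

namespace Per

/-- A real valued periodic function acts symmetrically. -/
theorem inner_smul_comm {B0 : ℝ} {b : Per} (hb : ∀ x, conj (b.1 x) = b.1 x) (f g : Sec B0) :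
    inner ℂ (b • f) g = inner ℂ f (b • g) := by
  rw [Sec.inner_def, Sec.inner_def]
  refine integral_congr_ae (Eventually.of_forall fun x => ?_)
  simp only [Sec.fn_per_smul, map_mul, hb]
  ring

theorem le_re_inner_smul {B0 : ℝ} {b : Per} {c : ℝ} (hb : ∀ x, conj (b.1 x) = b.1 x)
    (hc : ∀ x, c ≤ (b.1 x).re) (f : Sec B0) :
    c * ‖f‖ ^ 2 ≤ (inner ℂ f (b • f) : ℂ).re := by
  have hb' : ∀ x, b.1 x = ((b.1 x).re : ℂ) := fun x => (Complex.conj_eq_iff_re.1 (hb x)).symm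
  have h1 : inner ℂ f (b • f) = ((∫ x in fund, (b.1 x).re * ‖f.fn x‖ ^ 2 : ℝ) : ℂ) := by
    rw [Sec.inner_def, ← integral_complex_ofReal]
    refine integral_congr_ae (Eventually.of_forall fun x => ?_)
    simp only [Sec.fn_per_smul]
    rw [mul_left_comm, Complex.conj_mul']
    conv_lhs => rw [hb' x]
    push_cast
    rfl
  have hf := f.continuous
  have hbc := b.2.1
  rw [h1, Complex.ofReal_re, Sec.norm_sq, ← integral_const_mul]
  refine setIntegral_mono_on ?_ ?_ isCompact_fund.measurableSet fun x _ =>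
    mul_le_mul_of_nonneg_right (hc x) (sq_nonneg _)
  · exact (Continuous.continuousOn (by fun_prop)).integrableOn_compact isCompact_fund
  · exact (Continuous.continuousOn (by fun_prop)).integrableOn_compact isCompact_fund

end Per

namespace MagData

variable {D : MagData} {k : Pt} {b bk : Per} {u : Sec D.B0}

theorem norm_inner_U_smul_U_sub_le (hbk : PerD k b bk) (u : Sec D.B0) (σ ρ : ℝ) :
    ‖inner ℂ (D.U k σ u) (b • D.U k (σ + ρ) u) - inner ℂ u (b • D.U k ρ u)‖ ≤
      perBd bk * |σ| * (‖u‖ * ‖u‖) := by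
  rw [← U_U, inner_U_smul_U, ← inner_sub_right, ← sub_smul]
  have h := Sec.norm_inner_smul_le_of_bound (φ := Per.shift (-(σ • k)) b - b)
    (C := perBd bk * |σ|) (fun x => by
      have := norm_comp_add_sub_le hbk x (-σ)
      rw [neg_smul, abs_neg] at this
      exact this) u (D.U k ρ u)
  rwa [norm_U, mul_assoc] at h

theorem inner_U_smul_U_symm (hb : ∀ x, conj (b.1 x) = b.1 x) (u : Sec D.B0) (t r : ℝ) :
    inner ℂ (D.U k t u) (b • D.U k r u) = conj (inner ℂ (D.U k r u) (b • D.U k t u)) := by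
  rw [inner_conj_symm, Per.inner_smul_comm hb]

theorem norm_integral_inner_U_smul_U_le (hb : ∀ x, conj (b.1 x) = b.1 x) (hbk : PerD k b bk)
    (hu : ‖u‖ = 1) {T X t : ℝ}
    (hX : ∀ r, 0 ≤ r → r ≤ T → ‖∫ τ in (0 : ℝ)..r, inner ℂ u (b • D.U k τ u)‖ ≤ X)
    (ht : 0 ≤ t) (htT : t ≤ T) :
    ‖∫ r in (0 : ℝ)..T, inner ℂ (D.U k t u) (b • D.U k r u)‖ ≤ 2 * X + 2 * (perBd bk * T ^ 2) := by
  set G : ℝ → ℝ → ℂ := fun t r => inner ℂ (D.U k t u) (b • D.U k r u) with hG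
  set g : ℝ → ℂ := fun r => inner ℂ u (b • D.U k r u) with hg
  have hM := perBd_nonneg bk
  have hGc : ∀ t, Continuous (G t) := fun t => D.continuous_inner_smul_U k _ _ _
  have hgc : Continuous g := D.continuous_inner_smul_U k _ _ _
  have hd : ∀ σ ρ, ‖G σ (σ + ρ) - g ρ‖ ≤ perBd bk * |σ| := fun σ ρ => by
    have := norm_inner_U_smul_U_sub_le hbk u σ ρ
    rwa [hu, mul_one, mul_one] at this
  have i1 : ‖∫ r in (0 : ℝ)..t, G t r‖ ≤ X + perBd bk * T ^ 2 := by
    have e1 : ∫ r in (0 : ℝ)..t, G t r = ∫ τ in (0 : ℝ)..t, G t (t - τ) := by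
      rw [intervalIntegral.integral_comp_sub_left (G t) t]; simp
    have e2 : ‖∫ τ in (0 : ℝ)..t, (G t (t - τ) - conj (g τ))‖ ≤ perBd bk * t * |t - 0| := by
      refine intervalIntegral.norm_integral_le_of_norm_le_const fun τ hτ => ?_
      rw [Set.uIoc_of_le ht] at hτ
      have h1 := hd (t - τ) τ
      rw [sub_add_cancel, abs_of_nonneg (sub_nonneg.2 hτ.2)] at h1
      rw [hG]
      simp only []
      rw [inner_U_smul_U_symm hb, ← map_sub, RCLike.norm_conj]
      exact h1.trans (mul_le_mul_of_nonneg_left (by linarith [hτ.1]) hM)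
    have hgc' : Continuous fun τ => conj (g τ) := Complex.continuous_conj.comp hgc
    have hGs : Continuous fun τ => G t (t - τ) := (hGc t).comp (continuous_const.sub continuous_id)
    rw [intervalIntegral.integral_sub (hGs.intervalIntegrable _ _) (hgc'.intervalIntegrable _ _)] at e2
    have e3 : ∫ τ in (0 : ℝ)..t, conj (g τ) = conj (∫ τ in (0 : ℝ)..t, g τ) := by
      simp only [intervalIntegral.integral_of_le ht]
      exact integral_conj
    have e4 := hX t ht htT
    rw [← RCLike.norm_conj, ← e3] at e4
    have e5 := norm_add_le ((∫ τ in (0 : ℝ)..t, G t (t - τ)) - ∫ τ in (0 : ℝ)..t, conj (g τ))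
      (∫ τ in (0 : ℝ)..t, conj (g τ))
    rw [sub_add_cancel] at e5
    rw [sub_zero, abs_of_nonneg ht] at e2
    rw [e1]
    have e6 : perBd bk * t * t ≤ perBd bk * T ^ 2 := by
      have := ht.trans htT
      rw [mul_assoc, sq]; gcongr
    linarith
  have i2 : ‖∫ r in t..T, G t r‖ ≤ X + perBd bk * T ^ 2 := by
    have e1 : ∫ r in t..T, G t r = ∫ τ in (0 : ℝ)..T - t, G t (t + τ) := by
      rw [intervalIntegral.integral_comp_add_left (G t) t]; simp
    have e2 : ‖∫ τ in (0 : ℝ)..T - t, (G t (t + τ) - g τ)‖ ≤ perBd bk * |t| * |T - t - 0| :=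
      intervalIntegral.norm_integral_le_of_norm_le_const fun τ _ => hd t τ
    have hGs : Continuous fun τ => G t (t + τ) := (hGc t).comp (continuous_const.add continuous_id)
    rw [intervalIntegral.integral_sub (hGs.intervalIntegrable _ _) (hgc.intervalIntegrable _ _)] at e2
    have e4 := hX (T - t) (by linarith) (by linarith)
    have e5 := norm_add_le ((∫ τ in (0 : ℝ)..T - t, G t (t + τ)) - ∫ τ in (0 : ℝ)..T - t, g τ)
      (∫ τ in (0 : ℝ)..T - t, g τ)
    rw [sub_add_cancel] at e5
    rw [sub_zero, abs_of_nonneg ht, abs_of_nonneg (sub_nonneg.2 htT)] at e2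
    rw [e1]
    have e6 : perBd bk * t * (T - t) ≤ perBd bk * T ^ 2 := by
      rw [mul_assoc, sq]
      refine mul_le_mul_of_nonneg_left ?_ hM
      exact mul_le_mul htT (by linarith) (by linarith) (ht.trans htT)
    linarith
  rw [← intervalIntegral.integral_add_adjacent_intervals ((hGc t).intervalIntegrable 0 t)
    ((hGc t).intervalIntegrable t T)]
  refine (norm_add_le _ _).trans ?_
  linarith

/-- Smallness of the average of the transported quasimode. -/
theorem norm_sq_avg_le (hb : ∀ x, conj (b.1 x) = b.1 x) (hbk : PerD k b bk)
    (hu : ‖u‖ = 1) {c T X : ℝ} (hc : ∀ x, c ≤ (b.1 x).re) (hT : 0 ≤ T)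
    (hX : ∀ r, 0 ≤ r → r ≤ T → ‖∫ τ in (0 : ℝ)..r, inner ℂ u (b • D.U k τ u)‖ ≤ X) :
    c * ‖D.avg k u 0 T‖ ^ 2 ≤ T * (2 * X + 2 * (perBd bk * T ^ 2)) := by
  refine (Per.le_re_inner_smul hb hc _).trans ((Complex.re_le_norm _).trans ?_)
  rw [inner_smul_avg]
  have h := intervalIntegral.norm_integral_le_of_norm_le_const (a := 0) (b := T)
    (f := fun t => inner ℂ (D.avg k u 0 T) (b • D.U k t u))
    (C := 2 * X + 2 * (perBd bk * T ^ 2)) fun t ht => by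
      rw [Set.uIoc_of_le hT] at ht
      rw [← Per.inner_smul_comm hb, ← inner_conj_symm, RCLike.norm_conj, inner_smul_avg]
      exact norm_integral_inner_U_smul_U_le hb hbk hu hX ht.1.le ht.2
  rwa [sub_zero, abs_of_nonneg hT, mul_comm] at h

end MagData

end Positivity

section Oscillation

open Asymptotics

/-- The Fourier character `x ↦ e^{2πi m·x}`. -/
def char (m : ℤ × ℤ) : Per :=
  ⟨fun x => Complex.exp (2 * π * Complex.I * (dotp (lat m) x : ℂ)), by
    unfold dotp; fun_prop, fun n x => by
    simp only [dotp, lat]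
    refine Complex.exp_eq_exp_iff_exists_int.2 ⟨m.1 * n.1 + m.2 * n.2, ?_⟩
    push_cast
    ring⟩

theorem char_apply (m : ℤ × ℤ) (x : Pt) :
    (char m).1 x = Complex.exp (2 * π * Complex.I * (dotp (lat m) x : ℂ)) := rfl

theorem contDiff_char (m : ℤ × ℤ) (n : ℕ) : ContDiff ℝ n (char m).1 := by
  change ContDiff ℝ n fun x : Pt => Complex.exp (2 * π * Complex.I * (dotp (lat m) x : ℂ))
  unfold dotp
  have h : ContDiff ℝ n fun x : Pt => (((lat m).1 * x.1 + (lat m).2 * x.2 : ℝ) : ℂ) :=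
    Complex.ofRealCLM.contDiff.comp
      ((contDiff_const.mul contDiff_fst).add (contDiff_const.mul contDiff_snd))
  exact (contDiff_const.mul h).cexp

theorem perD_char (m : ℤ × ℤ) (d : Pt) :
    PerD d (char m) ((2 * π * Complex.I * (dotp (lat m) d : ℂ) : ℂ) • char m) := by
  refine ⟨contDiff_char m 1, fun x => ?_⟩
  have h1 := ((hasDerivAt_comp_line (contDiff_char m 1) d x 0))
  rw [zero_smul, add_zero] at h1
  refine HasDerivAt.unique ?_ h1
  have h2 : HasDerivAt (fun t : ℝ => dotp (lat m) (x + t • d)) (dotp (lat m) d) 0 := by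
    have h3 : HasDerivAt (fun t : ℝ => dotp (lat m) x + t * dotp (lat m) d) (dotp (lat m) d) 0 := by
      simpa using ((hasDerivAt_id (0 : ℝ)).mul_const (dotp (lat m) d)).const_add (dotp (lat m) x)
    refine h3.congr_of_eventuallyEq (Eventually.of_forall fun t => ?_)
    simp only [dotp, Prod.fst_add, Prod.snd_add, Prod.smul_fst, Prod.smul_snd, smul_eq_mul]
    ring
  have h4 := (h2.ofReal_comp.const_mul (2 * π * Complex.I)).cexp
  refine h4.congr_deriv ?_
  rw [zero_smul, add_zero]
  change _ = (2 * π * Complex.I * (dotp (lat m) d : ℂ) : ℂ) * (char m).1 x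
  rw [char_apply]
  ring

namespace MagData

variable {D : MagData} {m : ℤ × ℤ}

namespace Cfg

/-- The error in the oscillation estimate. -/
theorem isBigO_oscillation (hm : m ≠ 0) :
    (fun c : Cfg D (lat m) => (c.h : ℂ) ^ 2 * inner ℂ c.u (char m • D.U (lat m) c.t c.jet.P)) =O[⊤]
      fun c => ‖c.e‖ + c.h ^ 2 + c.h * c.t := by
  set k := lat m with hkdef
  have hK := nsq_lat_pos hm
  set κ : ℂ := 2 * π * Complex.I * nsq k with hκ
  have hk : PerD k (char m) (κ • char m) := perD_char m k
  have hp : PerD (perp k) (char m) 0 := by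
    have h := perD_char m (perp k)
    have h0 : dotp (lat m) (perp k) = 0 := by rw [hkdef]; simp only [dotp, perp]; ring
    rwa [h0, Complex.ofReal_zero, mul_zero, zero_smul] at h
  have hkk : PerD k (κ • char m) (κ • κ • char m) := by
    refine ⟨hk.1.const_smul κ, fun x => ?_⟩
    have h1 : DifferentiableAt ℝ (char m).1 x := hk.1.differentiable (by simp) x
    have h2 : fderiv ℝ (κ • char m).1 x k = κ * fderiv ℝ (char m).1 x k := by
      have := fderiv_const_smul h1 κ
      change fderiv ℝ (κ • (char m).1) x k = _
      rw [this]
      rfl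
    rw [h2, ← hk.2]
    rfl
  have hnn : ∀ c : Cfg D k, 0 ≤ ‖c.e‖ ∧ 0 ≤ c.h ^ 2 ∧ 0 ≤ c.h * c.t := fun c =>
    ⟨norm_nonneg _, sq_nonneg _, mul_nonneg c.h_pos.le c.t_nonneg⟩
  have a1 : _ =O[⊤] fun c : Cfg D k => ‖c.e‖ + c.h ^ 2 + c.h * c.t :=
    isBigO_mono (isBigO_inner (char m) (isBigO_e (D := D) (k := k)) isBigO_u) fun c => by
      rw [mul_one, abs_of_nonneg (norm_nonneg _)]; linarith [hnn c]
  have a2 : _ =O[⊤] fun c : Cfg D k => ‖c.e‖ + c.h ^ 2 + c.h * c.t :=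
    isBigO_mono (isBigO_inner (char m) (isBigO_u (D := D) (k := k)) isBigO_e) fun c => by
      rw [one_mul, abs_of_nonneg (norm_nonneg _)]; linarith [hnn c]
  have a3 : _ =O[⊤] fun c : Cfg D k => ‖c.e‖ + c.h ^ 2 + c.h * c.t :=
    isBigO_mono (isBigO_hsq_mul (isBigO_inner (char m) (isBigO_u (D := D) (k := k)) isBigO_u))
      fun c => by rw [mul_one, mul_one, abs_of_nonneg (sq_nonneg _)]; linarith [hnn c]
  have a4 : _ =O[⊤] fun c : Cfg D k => ‖c.e‖ + c.h ^ 2 + c.h * c.t :=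
    isBigO_mono (isBigO_hsq_mul (isBigO_inner_bet (char m) (isBigO_R (D := D) (k := k)) isBigO_u))
      fun c => by
        have := c.h_pos
        rw [show c.h ^ 2 * (c.t * (1 / c.h * 1)) = c.h * c.t by field_simp,
          abs_of_nonneg (hnn c).2.2]
        linarith [hnn c]
  have a5 : _ =O[⊤] fun c : Cfg D k => ‖c.e‖ + c.h ^ 2 + c.h * c.t :=
    isBigO_mono (isBigO_hsq_mul (isBigO_inner_bet (char m) (isBigO_u (D := D) (k := k)) isBigO_R))
      fun c => by
        have := c.h_pos
        rw [show c.h ^ 2 * (c.t * (1 * (1 / c.h))) = c.h * c.t by field_simp,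
          abs_of_nonneg (hnn c).2.2]
        linarith [hnn c]
  have hK' : (nsq k : ℂ) ≠ 0 := by exact_mod_cast hK.ne'
  have hκ0 : Complex.I * κ ≠ 0 := by
    simp [hκ, hK', Complex.I_ne_zero, Real.pi_ne_zero]
  have key := ((((a2.sub a1).const_mul_left (nsq k : ℂ)).sub (a3.const_mul_left (κ ^ 2))).add
    ((a4.add a5).const_mul_left (nsq k : ℂ))).const_mul_left ((2 * (Complex.I * κ))⁻¹)
  refine key.congr_left fun c => ?_
  have id := c.jet.commutator_mul hk hp hkk c.t
  simp only [zero_smul, inner_zero_right, smul_assoc, inner_smul_right] at id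
  rw [inv_mul_eq_iff_eq_mul₀ (mul_ne_zero two_ne_zero hκ0)]
  linear_combination -id - (c.h : ℂ) ^ 2 * κ ^ 2 * inner ℂ c.u (char m • D.U k c.t c.u) * Complex.I_sq

end Cfg

end MagData

end Oscillation

section FourierDecay

open Asymptotics

namespace MagData

variable {D : MagData} {m : ℤ × ℤ}

theorem DD.norm_inner_smul_U_sub_le {k : Pt} {y y' : Sec D.B0} (hy : D.DD k y y') (z : Sec D.B0)
    (φ : Per) {t Y : ℝ} (ht : 0 ≤ t)
    (hY : ∀ s, 0 ≤ s → s ≤ t → ‖inner ℂ z (φ • D.U k s y')‖ ≤ Y) :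
    ‖inner ℂ z (φ • D.U k t y) - inner ℂ z (φ • y)‖ ≤ Y * t := by
  have h1 := hy.U_sub_U 0 t
  rw [U_zero] at h1
  rw [← inner_sub_right, ← smul_sub, h1, smul_comm φ, inner_smul_right, norm_mul, Complex.norm_I,
    one_mul, inner_smul_avg]
  have h2 := intervalIntegral.norm_integral_le_of_norm_le_const (a := 0) (b := t)
    (f := fun s => inner ℂ z (φ • D.U k s y')) (C := Y) fun s hs => by
      rw [Set.uIoc_of_le ht] at hs
      exact hY s hs.1.le hs.2
  rwa [sub_zero, abs_of_nonneg ht] at h2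

namespace Cfg

theorem exists_norm_avg_le (hm : m ≠ 0) (hB : ∀ x, 0 < lineInt (perp (lat m)) D.B 1 x) :
    ∃ N, 0 ≤ N ∧ ∀ (c : Cfg D (lat m)) (s q : ℝ), 0 < s → s ^ 2 = c.h → 0 < q → q ≤ 1 →
      s ≤ q ^ 4 → c.err ≤ q ^ 8 * s → c.t = q ^ 2 * s →
      ‖D.avg (lat m) c.u 0 c.t‖ ≤ c.t * q * N := by
  obtain ⟨C, hC, hi⟩ := exists_norm_integral_fieldAvg_le D hm
  obtain ⟨c₀, hc₀, hlow⟩ := D.exists_fieldAvg_lower_bound hB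
  obtain ⟨bk, hbk⟩ := exists_perD (D.fieldAvg (perp (lat m))) (D.contDiff_fieldAvg _ 1) (lat m)
  have hM := perBd_nonneg bk
  refine ⟨√((2 * C + 2 * perBd bk) / c₀), Real.sqrt_nonneg _,
    fun c s q hs hsh hq hq1 hsq herr ht => ?_⟩
  have hX : ∀ r, 0 ≤ r → r ≤ c.t → ‖∫ τ in (0 : ℝ)..r,
      inner ℂ c.u (D.fieldAvg (perp (lat m)) • D.U (lat m) τ c.u)‖ ≤ C * (s * q ^ 4) :=
    fun r hr hrt => hi (c.setTime r hr hrt) s (q ^ 4) hs hsh (by positivity) hsq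
      (herr.trans_eq (by ring))
  have h1 := norm_sq_avg_le (fun x => Complex.conj_ofReal _) hbk c.norm_u hlow c.t_nonneg hX
  refine (abs_le_of_sq_le_sq' ?_ (mul_nonneg (mul_nonneg c.t_nonneg hq.le)
    (Real.sqrt_nonneg _))).2
  rw [mul_pow, Real.sq_sqrt (by positivity), mul_div_assoc', le_div_iff₀ hc₀, mul_comm]
  refine h1.trans ?_
  have hs1 : s ≤ 1 := hsq.trans (pow_le_one₀ hq.le hq1)
  have h2 : c.t ^ 2 ≤ s * q ^ 4 := by
    rw [ht, show (q ^ 2 * s) ^ 2 = s * (s * q ^ 4) by ring]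
    exact mul_le_of_le_one_left (by positivity) hs1
  have h3 := mul_le_mul_of_nonneg_left h2 hM
  calc c.t * (2 * (C * (s * q ^ 4)) + 2 * (perBd bk * c.t ^ 2))
      ≤ c.t * (2 * (C * (s * q ^ 4)) + 2 * (perBd bk * (s * q ^ 4))) :=
        mul_le_mul_of_nonneg_left (by linarith) c.t_nonneg
    _ = (c.t * q) ^ 2 * (2 * C + 2 * perBd bk) := by rw [ht]; ring

/-- Quantitative decay of the Fourier coefficients of the position density of a quasimode. -/
theorem exists_norm_inner_char_le (hm : m ≠ 0) (hB : ∀ x, 0 < lineInt (perp (lat m)) D.B 1 x) :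
    ∃ C, 0 ≤ C ∧ ∀ (c : Cfg D (lat m)) (s q : ℝ), 0 < s → s ^ 2 = c.h → 0 < q → q ≤ 1 →
      s ≤ q ^ 4 → c.err ≤ q ^ 8 * s → c.t = q ^ 2 * s →
      ‖inner ℂ c.u (char m • c.u)‖ ≤ C * q := by
  obtain ⟨N, hN, hF⟩ := exists_norm_avg_le (D := D) hm hB
  obtain ⟨C, hC⟩ := isBigO_top.1 (isBigO_oscillation (D := D) hm)
  have hA := perBd_nonneg (char m)
  refine ⟨perBd (char m) * N + 3 * |C|, by positivity, fun c s q hs hsh hq hq1 hsq herr ht => ?_⟩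
  have hFc := hF c s q hs hsh hq hq1 hsq herr ht
  have hs1 : s ≤ 1 := hsq.trans (pow_le_one₀ hq.le hq1)
  have htpos : 0 < c.t := by rw [ht]; positivity
  have hts : c.t ≤ s := by
    rw [ht]; exact mul_le_of_le_one_left hs.le (pow_le_one₀ hq.le hq1)
  have he : ‖c.e‖ ≤ s ^ 3 := by
    have h1 := c.norm_e_div_le.trans herr
    rw [div_le_iff₀ c.h_pos, ← hsh] at h1
    refine h1.trans ?_
    rw [show q ^ 8 * s * s ^ 2 = q ^ 8 * s ^ 3 by ring]
    exact mul_le_of_le_one_left (by positivity) (pow_le_one₀ hq.le hq1)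
  have hY : ∀ r, 0 ≤ r → r ≤ c.t →
      ‖inner ℂ c.u (char m • D.U (lat m) r c.jet.P)‖ ≤ 3 * |C| / s := fun r hr hrt => by
    have h1 := hC (c.setTime r hr hrt)
    change ‖(c.h : ℂ) ^ 2 * inner ℂ c.u (char m • D.U (lat m) r c.jet.P)‖ ≤
      C * ‖‖c.e‖ + c.h ^ 2 + c.h * r‖ at h1
    have hhr : 0 ≤ c.h * r := mul_nonneg c.h_pos.le hr
    rw [norm_mul, norm_pow, Complex.norm_real, Real.norm_of_nonneg c.h_pos.le,
      Real.norm_of_nonneg (by positivity)] at h1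
    rw [le_div_iff₀ hs]
    generalize ‖inner ℂ c.u (char m • D.U (lat m) r c.jet.P)‖ = X at h1 ⊢
    rw [← hsh] at h1
    have h2 : ‖c.e‖ + (s ^ 2) ^ 2 + s ^ 2 * r ≤ 3 * s ^ 3 := by
      have e1 : (s ^ 2) ^ 2 ≤ s ^ 3 := by
        rw [← pow_mul]; exact pow_le_pow_of_le_one hs.le hs1 (by norm_num)
      have e2 : s ^ 2 * r ≤ s ^ 3 := by
        rw [pow_succ s 2]; exact mul_le_mul_of_nonneg_left (hrt.trans hts) (by positivity)
      linarith
    have h3 : 0 ≤ ‖c.e‖ + (s ^ 2) ^ 2 + s ^ 2 * r := by positivity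
    have h4 : C * (‖c.e‖ + (s ^ 2) ^ 2 + s ^ 2 * r) ≤ |C| * (3 * s ^ 3) :=
      mul_le_mul (le_abs_self C) h2 h3 (abs_nonneg C)
    have h5 := h1.trans h4
    have hs3 : 0 < s ^ 3 := by positivity
    refine le_of_mul_le_mul_right ?_ hs3
    linarith [show X * s * s ^ 3 = (s ^ 2) ^ 2 * X by ring]
  have hd : ∀ r, 0 ≤ r → r ≤ c.t → ‖inner ℂ c.u (char m • D.U (lat m) r c.u) -
      inner ℂ c.u (char m • c.u)‖ ≤ 3 * |C| / s * c.t := fun r hr hrt =>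
    (c.jet.hP.norm_inner_smul_U_sub_le c.u (char m) hr
      fun s' h0 h1 => hY s' h0 (h1.trans hrt)).trans
      (mul_le_mul_of_nonneg_left hrt (by positivity))
  have h1 := intervalIntegral.norm_integral_le_of_norm_le_const (a := 0) (b := c.t)
    (f := fun r => inner ℂ c.u (char m • D.U (lat m) r c.u) - inner ℂ c.u (char m • c.u))
    fun r hr => by
      rw [Set.uIoc_of_le c.t_nonneg] at hr
      exact hd r hr.1.le hr.2
  rw [intervalIntegral.integral_sub ((D.continuous_inner_smul_U _ _ _ _).intervalIntegrable _ _)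
    intervalIntegrable_const, ← inner_smul_avg, intervalIntegral.integral_const, sub_zero,
    abs_of_nonneg c.t_nonneg] at h1
  have h2 : ‖inner ℂ c.u (char m • D.avg (lat m) c.u 0 c.t)‖ ≤ perBd (char m) * (c.t * q * N) := by
    have := Sec.norm_inner_smul_le_of_bound (norm_le_perBd (char m)) c.u (D.avg (lat m) c.u 0 c.t)
    rw [c.norm_u, mul_one] at this
    exact this.trans (mul_le_mul_of_nonneg_left hFc hA)
  have h3 := norm_sub_le (inner ℂ c.u (char m • D.avg (lat m) c.u 0 c.t))
    (inner ℂ c.u (char m • D.avg (lat m) c.u 0 c.t) - c.t • inner ℂ c.u (char m • c.u))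
  rw [sub_sub_cancel, norm_smul, Real.norm_of_nonneg c.t_nonneg] at h3
  have h4 : 3 * |C| / s * c.t ≤ 3 * |C| * q := by
    rw [ht, div_mul_eq_mul_div, div_le_iff₀ hs]
    have : q ^ 2 * s ≤ q * s :=
      mul_le_mul_of_nonneg_right (by nlinarith) hs.le
    have := mul_le_mul_of_nonneg_left this (show 0 ≤ 3 * |C| by positivity)
    linarith
  refine le_of_mul_le_mul_left ?_ htpos
  have h5 := mul_le_mul_of_nonneg_right h4 c.t_nonneg
  linarith

end Cfg

end MagData

end FourierDecay

namespace MagData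

theorem integral_char {m : ℤ × ℤ} (hm : m ≠ 0) : ∫ x in fund, (char m).1 x = 0 := by
  have h1 := integral_fund_fderiv (contDiff_char m 1) (char m).2.2 (lat m)
  have h2 : ∀ x, fderiv ℝ (char m).1 x (lat m) =
      (2 * π * Complex.I * (dotp (lat m) (lat m) : ℂ)) * (char m).1 x :=
    fun x => ((perD_char m (lat m)).2 x).symm
  simp only [h2] at h1
  rw [integral_const_mul] at h1
  have h3 : (dotp (lat m) (lat m) : ℂ) ≠ 0 := by exact_mod_cast (nsq_lat_pos hm).ne'
  exact (mul_eq_zero.1 h1).resolve_left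
    (mul_ne_zero Complex.two_pi_I_ne_zero h3)

theorem inner_char (D : MagData) (m : ℤ × ℤ) (f : Sec D.B0) :
    inner ℂ f (char m • f) = ∫ x in fund, (char m).1 x * ((‖f.fn x‖ ^ 2 : ℝ) : ℂ) := by
  rw [Sec.inner_def]
  congr 1
  funext x
  rw [Sec.fn_per_smul, ← Complex.normSq_eq_norm_sq, Complex.normSq_eq_conj_mul_self]
  ring

variable {D : MagData}

theorem tendsto_inner_char {m : ℤ × ℤ} (hm : m ≠ 0)
    (hB : ∀ x, 0 < lineInt (perp (lat m)) D.B 1 x) {h : ℕ → ℝ} (hh : ∀ n, 0 < h n)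
    (hh0 : Tendsto h atTop (𝓝 0)) {u e : ℕ → Sec D.B0} (hu : ∀ n, ContDiff ℝ 2 (u n).fn)
    (he : ∀ n x, (e n).fn x = ((h n ^ 2 : ℝ) : ℂ) * magLap D.α D.A (u n).fn x - (u n).fn x)
    (hu1 : ∀ n, ‖u n‖ = 1)
    (hqm : Tendsto (fun n => ‖e n‖ / √(h n) ^ 3) atTop (𝓝 0)) :
    Tendsto (fun n => inner ℂ (u n) (char m • u n)) atTop (𝓝 0) := by
  obtain ⟨C, hC, hb⟩ := Cfg.exists_norm_inner_char_le (D := D) hm hB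
  have hs0 : Tendsto (fun n => √(h n)) atTop (𝓝 0) := by
    simpa using hh0.sqrt
  set p : ℕ → ℝ := fun n => ‖e n‖ / √(h n) ^ 3 + √(h n) with hp
  have hp0 : Tendsto p atTop (𝓝 0) := by simpa using hqm.add hs0
  set q : ℕ → ℝ := fun n => p n ^ ((1 : ℝ) / 8) with hq
  have hq0 : Tendsto q atTop (𝓝 0) := by
    have := hp0.rpow_const (p := (1 : ℝ) / 8) (Or.inr (by norm_num))
    rwa [Real.zero_rpow (by norm_num)] at this
  have hspos : ∀ n, 0 < √(h n) := fun n => Real.sqrt_pos.2 (hh n)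
  have hppos : ∀ n, 0 < p n := fun n => add_pos_of_nonneg_of_pos
    (div_nonneg (norm_nonneg _) (pow_pos (hspos n) 3).le) (hspos n)
  have hqpos : ∀ n, 0 < q n := fun n => Real.rpow_pos_of_pos (hppos n) _
  have hq8 : ∀ n, q n ^ 8 = p n := fun n => by
    rw [hq, ← Real.rpow_natCast, ← Real.rpow_mul (hppos n).le]; norm_num
  refine squeeze_zero_norm' (a := fun n => C * q n) ?_ (by simpa using hq0.const_mul C)
  filter_upwards [hq0.eventually_le_const one_pos, hs0.eventually_le_const one_pos] with n hq1 hs1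
  set s := √(h n) with hs
  have hsh : s ^ 2 = h n := Real.sq_sqrt (hh n).le
  have hs_pos := hspos n
  have hp1 : p n ≤ 1 := by rw [← hq8]; exact pow_le_one₀ (hqpos n).le hq1
  have hsp : s ≤ p n := le_add_of_nonneg_left (div_nonneg (norm_nonneg _) (pow_pos hs_pos 3).le)
  have hep : ‖e n‖ + s ^ 4 = p n * s ^ 3 := by
    change _ = (‖e n‖ / s ^ 3 + s) * s ^ 3
    rw [add_mul, div_mul_cancel₀ _ (pow_pos hs_pos 3).ne']
    ring
  have hsq : s ≤ q n ^ 4 := by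
    refine (abs_le_of_sq_le_sq' ?_ (pow_nonneg (hqpos n).le 4)).2
    rw [← pow_mul, hq8]
    exact (pow_le_of_le_one hs_pos.le hs1 two_ne_zero).trans hsp
  have hh1 : h n ≤ 1 := by rw [← hsh]; exact pow_le_one₀ hs_pos.le hs1
  have hq2 : q n ^ 2 ≤ 1 := pow_le_one₀ (hqpos n).le hq1
  obtain ⟨j⟩ := D.exists_jet (u n) (e n) (hu n) (lat m) (h n) (he n)
  let c : Cfg D (lat m) :=
    { h := h n, t := q n ^ 2 * s, u := u n, e := e n, jet := j, h_pos := hh n, h_le := hh1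
      norm_u := hu1 n
      norm_e := by
        have h1 : p n * s ^ 3 ≤ 1 := mul_le_one₀ hp1 (by positivity) (pow_le_one₀ hs_pos.le hs1)
        have h2 : 0 ≤ s ^ 4 := by positivity
        linarith
      t_nonneg := by positivity
      t_sq := by
        rw [← hsh]
        exact pow_le_pow_left₀ (by positivity) (mul_le_of_le_one_left hs_pos.le hq2) 2 }
  refine hb c s (q n) hs_pos hsh (hqpos n) hq1 hsq ?_ rfl
  change ‖e n‖ / h n + h n ≤ _
  rw [hq8, ← hsh, ← mul_le_mul_iff_left₀ (pow_pos hs_pos 2), add_mul, div_mul_cancel₀ _ (by positivity)]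
  linarith [hep]

end MagData

section Density

/-- The projection of the plane onto the torus. -/
def torusMk (x : Pt) : UnitAddTorus (Fin 2) := ![(x.1 : UnitAddCircle), (x.2 : UnitAddCircle)]

theorem continuous_torusMk : Continuous torusMk := by
  refine continuous_pi fun i => ?_
  fin_cases i
  · exact (AddCircle.continuous_mk' 1).comp continuous_fst
  · exact (AddCircle.continuous_mk' 1).comp continuous_snd

theorem mFourier_torusMk (m : Fin 2 → ℤ) (x : Pt) :
    UnitAddTorus.mFourier m (torusMk x) = (char (m 0, m 1)).1 x := by
  rw [char_apply]
  change ∏ i, fourier (m i) (torusMk x i) = _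
  rw [Fin.prod_univ_two]
  change fourier (m 0) (x.1 : UnitAddCircle) * fourier (m 1) (x.2 : UnitAddCircle) = _
  rw [fourier_coe_apply, fourier_coe_apply, ← Complex.exp_add]
  congr 1
  simp only [dotp, lat]
  push_cast
  ring

theorem IsPeriodic.exists_torus_lift {a : Pt → ℂ} (ha : Continuous a) (hp : IsPeriodic a) :
    ∃ G : C(UnitAddTorus (Fin 2), ℂ), ∀ x, G (torusMk x) = a x := by
  have hq : IsOpenQuotientMap (fun t : ℝ => (t : UnitAddCircle)) :=
    QuotientAddGroup.isOpenQuotientMap_mk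
  have hqq := hq.prodMap hq
  let g : UnitAddCircle × UnitAddCircle → ℂ := fun z => a (Quotient.out z.1, Quotient.out z.2)
  have hout : ∀ t : ℝ, ∃ n : ℤ, (Quotient.out (t : UnitAddCircle) : ℝ) = t + n := fun t => by
    have h1 : ((Quotient.out (t : UnitAddCircle) : ℝ) : UnitAddCircle) = t := Quotient.out_eq _
    obtain ⟨n, hn⟩ := (QuotientAddGroup.eq_iff_sub_mem.1 h1)
    refine ⟨n, ?_⟩
    simp at hn
    linarith
  have hg : ∀ x : Pt, g ((x.1 : UnitAddCircle), (x.2 : UnitAddCircle)) = a x := fun x => by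
    obtain ⟨n₁, h₁⟩ := hout x.1
    obtain ⟨n₂, h₂⟩ := hout x.2
    change a (_, _) = _
    rw [h₁, h₂]
    exact hp (n₁, n₂) x
  have hgc : Continuous g := by
    rw [← hqq.continuous_comp_iff]
    exact ha.congr fun x => (hg x).symm
  exact ⟨⟨fun z => g (z 0, z 1), hgc.comp (by fun_prop)⟩, hg⟩

/-- Weak convergence of densities on the torus follows from convergence of Fourier coefficients. -/
theorem tendsto_integral_mul_of_char {ρ : ℕ → Pt → ℝ} (hc : ∀ n, Continuous (ρ n))
    (h0 : ∀ n x, 0 ≤ ρ n x) (h1 : ∀ n, ∫ x in fund, ρ n x = 1)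
    (hm : ∀ m : ℤ × ℤ, m ≠ 0 →
      Tendsto (fun n => ∫ x in fund, (char m).1 x * (ρ n x : ℂ)) atTop (𝓝 0))
    {a : Pt → ℂ} (ha : Continuous a) (hp : IsPeriodic a) :
    Tendsto (fun n => ∫ x in fund, a x * (ρ n x : ℂ)) atTop (𝓝 (∫ x in fund, a x)) := by
  have hInt : ∀ {f : Pt → ℂ} {r : Pt → ℝ}, Continuous f → Continuous r →
      Integrable (fun x => f x * (r x : ℂ)) (volume.restrict fund) :=
    fun hf hr => integrable_fund (hf.mul (Complex.continuous_ofReal.comp hr))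
  have hpc : ∀ p : C(UnitAddTorus (Fin 2), ℂ), Continuous fun x => p (torusMk x) :=
    fun p => p.continuous.comp continuous_torusMk
  have hspan : ∀ p ∈ Submodule.span ℂ (Set.range (UnitAddTorus.mFourier (d := Fin 2))),
      Tendsto (fun n => ∫ x in fund, p (torusMk x) * (ρ n x : ℂ)) atTop
        (𝓝 (∫ x in fund, p (torusMk x))) := fun p hps => by
    induction hps using Submodule.span_induction with
    | mem p hp =>
      obtain ⟨m, rfl⟩ := hp
      simp only [mFourier_torusMk]
      by_cases hm0 : (m 0, m 1) = (0 : ℤ × ℤ)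
      · rw [hm0]
        have h2 : ∀ x, (char 0).1 x = 1 := fun x => by simp [char_apply, dotp, lat]
        simp only [h2, one_mul]
        have h3 : ∀ n, ∫ x in fund, (ρ n x : ℂ) = 1 := fun n => by
          rw [integral_complex_ofReal, h1, Complex.ofReal_one]
        simp [h3, volume_real_fund]
      · rw [MagData.integral_char hm0]
        exact hm _ hm0
    | zero => simp
    | add p q _ _ hp hq =>
      have e : ∀ n, ∫ x in fund, (p + q) (torusMk x) * (ρ n x : ℂ) =
          (∫ x in fund, p (torusMk x) * (ρ n x : ℂ)) + ∫ x in fund, q (torusMk x) * (ρ n x : ℂ) :=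
        fun n => by
          rw [← integral_add (hInt (hpc p) (hc n)) (hInt (hpc q) (hc n))]
          simp only [ContinuousMap.add_apply, add_mul]
      simp only [e]
      simp only [ContinuousMap.add_apply]
      rw [integral_add (integrable_fund (hpc p)) (integrable_fund (hpc q))]
      exact hp.add hq
    | smul c p _ hp =>
      simp only [ContinuousMap.smul_apply, smul_eq_mul, mul_assoc, integral_const_mul]
      exact hp.const_mul c
  obtain ⟨G, hG⟩ := hp.exists_torus_lift ha
  rw [Metric.tendsto_atTop]
  intro ε hε
  have hmem : G ∈ closure
      (Submodule.span ℂ (Set.range (UnitAddTorus.mFourier (d := Fin 2))) : Set _) := by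
    rw [← Submodule.topologicalClosure_coe, UnitAddTorus.span_mFourier_closure_eq_top]
    trivial
  obtain ⟨p, hps, hpG⟩ := Metric.mem_closure_iff.1 hmem (ε / 3) (by positivity)
  have hb : ∀ x, ‖a x - p (torusMk x)‖ ≤ ε / 3 := fun x => by
    rw [← hG, ← dist_eq_norm]
    exact (ContinuousMap.dist_apply_le_dist _).trans hpG.le
  have key : ∀ {r : Pt → ℝ}, Continuous r → (∀ x, 0 ≤ r x) → ∫ x in fund, r x = 1 →
      ‖(∫ x in fund, a x * (r x : ℂ)) - ∫ x in fund, p (torusMk x) * (r x : ℂ)‖ ≤ ε / 3 := by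
    intro r hr hr0 hr1
    rw [← integral_sub (hInt ha hr) (hInt (hpc p) hr)]
    refine (norm_integral_le_of_norm_le ((integrable_fund hr).const_mul (ε / 3))
      (Eventually.of_forall fun x => ?_)).trans_eq ?_
    · rw [← sub_mul, norm_mul, Complex.norm_real, Real.norm_of_nonneg (hr0 x)]
      exact mul_le_mul_of_nonneg_right (hb x) (hr0 x)
    · rw [integral_const_mul, hr1, mul_one]
  have key1 := key (r := fun _ => 1) continuous_const (fun _ => zero_le_one)
    (by simp [volume_real_fund])
  simp only [Complex.ofReal_one, mul_one] at key1
  obtain ⟨N, hN⟩ := Metric.tendsto_atTop.1 (hspan p hps) (ε / 3) (by positivity)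
  refine ⟨N, fun n hn => ?_⟩
  have h2 := hN n hn
  have h3 := key (hc n) (h0 n) (h1 n)
  rw [← dist_eq_norm] at h3 key1
  rw [dist_comm] at key1
  linarith [dist_triangle4 (∫ x in fund, a x * (ρ n x : ℂ)) (∫ x in fund, p (torusMk x) * (ρ n x : ℂ))
    (∫ x in fund, p (torusMk x)) (∫ x in fund, a x)]

end Density

section Conclusion

theorem MagData.exists_error (D : MagData) (u : Sec D.B0) (hu : ContDiff ℝ 2 u.fn) (h : ℝ) :
    ∃ e : Sec D.B0, ∀ x, e.fn x = ((h ^ 2 : ℝ) : ℂ) * magLap D.α D.A u.fn x - u.fn x := by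
  have hu1 : ContDiff ℝ 1 u.fn := hu.of_le (by norm_num)
  obtain ⟨P, hP⟩ := exists_DD u hu1 (1, 0)
  obtain ⟨R, hR⟩ := exists_DD u hu1 (0, 1)
  obtain ⟨PP, hPP⟩ := exists_DD P (hP.contDiff_one hu) (1, 0)
  obtain ⟨RR, hRR⟩ := exists_DD R (hR.contDiff_one hu) (0, 1)
  have h1 : ∀ {f g : Sec D.B0}, D.DD (1, 0) f g → g.fn = Dop1 D.α D.A f.fn := fun hd => by
    funext x
    rw [hd.2]
    simp [Dop1, pd1, al, dotp]
  have h2 : ∀ {f g : Sec D.B0}, D.DD (0, 1) f g → g.fn = Dop2 D.α D.A f.fn := fun hd => by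
    funext x
    rw [hd.2]
    simp [Dop2, pd2, al, dotp]
  refine ⟨((h ^ 2 : ℝ) : ℂ) • (PP + RR) - u, fun x => ?_⟩
  rw [Sec.fn_sub, Sec.fn_smul, Sec.fn_add, h1 hPP, h2 hRR, h1 hP, h2 hR, magLap]

/-- The magnetic data attached to a periodic field and a vector potential. -/
def MagData.ofPotential (B : Pt → ℝ) (hB : ContDiff ℝ (⊤ : ℕ∞) B) (hBper : IsPeriodic B) (B0 : ℝ)
    (Aper : Pt → Pt) (hAper : ContDiff ℝ (⊤ : ℕ∞) Aper) (hAperper : IsPeriodic Aper)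
    (A : Pt → Pt) (hA : ∀ x, A x = A0 B0 x + Aper x)
    (hcurl : ∀ x, pdR1 (fun y => (A y).2) x - pdR2 (fun y => (A y).1) x = B x)
    (α : Pt) : MagData :=
  have hAs : ContDiff ℝ (⊤ : ℕ∞) A := by
    rw [funext hA]
    unfold A0
    fun_prop
  { α := α, A := A, B := B, B0 := B0, contDiff_A := hAs
    A_add_lat := fun m x => by
      have h := hAperper m x
      change Aper (x + lat m) = Aper x at h
      rw [hA, hA, h]
      ext <;> simp only [A0, Prod.fst_add, Prod.snd_add] <;> ring
    contDiff_B := hB, isPeriodic_B := hBper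
    curl := fun x v w => by
      have hd : HasFDerivAt A (fderiv ℝ A x) x := (hAs.differentiable (by simp) x).hasFDerivAt
      have h := hcurl x
      have e1 : fderiv ℝ (fun y => (A y).1) x = _ := hd.fst.fderiv
      have e2 : fderiv ℝ (fun y => (A y).2) x = _ := hd.snd.fderiv
      have hv : ∀ y : Pt, fderiv ℝ A x y =
          y.1 • fderiv ℝ A x (1, 0) + y.2 • fderiv ℝ A x (0, 1) := fun y => by
        rw [← map_smul, ← map_smul, ← map_add]
        congr 1
        ext <;> simp
      rw [pdR1, pdR2, e1, e2] at h
      change (fderiv ℝ A x (1, 0)).2 - (fderiv ℝ A x (0, 1)).1 = B x at h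
      rw [hv v, hv w, ← h]
      simp only [dotp, wedge, Prod.fst_add, Prod.snd_add, Prod.smul_fst, Prod.smul_snd, smul_eq_mul]
      ring }

theorem apply_add_lat_of_magTrans {B0 : ℝ} {m : ℤ × ℤ} {u : Pt → ℂ} (h : magTrans B0 m u = u)
    (x : Pt) : u (x + lat m) = latPhase B0 m x * u x := by
  have h1 := congrFun h (x + lat m)
  have h2 : wedge (lat m) (x + lat m) = wedge (lat m) x := by
    simp only [wedge, Prod.fst_add, Prod.snd_add]; ring
  have h3 : (((x + lat m).1 - m.1, (x + lat m).2 - m.2) : Pt) = x := by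
    ext <;> simp [lat]
  rw [← h1, magTrans, h3, latPhase, ← h2]
  congr 2
  change _ * ((wedge (lat m) (x + lat m) : ℝ) : ℂ) = _
  push_cast
  ring

end Conclusion

end

/-- Theorem 6.1 / second part of Theorem 1.1: under the geometric
control condition `B_∞ > 0`, the only quantum limit of `o(h^{3/2})`-quasimodes of
`h²𝓛_α` is the Lebesgue measure on `𝕋²`. -/
theorem statement15
    (B : Pt → ℝ) (hBsm : ContDiff ℝ (⊤ : ℕ∞) B) (hBper : IsPeriodic B)
    (B0 : ℝ) (hB0 : B0 = ∫ x in fund, B x) (hflux : ∃ k : ℤ, B0 = 2 * π * k)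
    (Aper : Pt → Pt) (hApersm : ContDiff ℝ (⊤ : ℕ∞) Aper) (hAperper : IsPeriodic Aper)
    (A : Pt → Pt) (hA : ∀ x, A x = A0 B0 x + Aper x)
    (hcurl : ∀ x, pdR1 (fun y => (A y).2) x - pdR2 (fun y => (A y).1) x = B x)
    (Binf : Pt → Pt → ℝ)
    (hBinf : ∀ x θ : Pt, Tendsto (fun T : ℝ => (1 / T) * ∫ t in (0:ℝ)..T, B (x + t • θ))
      atTop (𝓝 (Binf x θ)))
    (hpos : ∀ x θ : Pt, θ.1 ^ 2 + θ.2 ^ 2 = 1 → 0 < Binf x θ)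
    (α : Pt)
    (h : ℕ → ℝ) (hhpos : ∀ n, 0 < h n) (hh0 : Tendsto h atTop (𝓝 0))
    (u : ℕ → Pt → ℂ) (huC2 : ∀ n, ContDiff ℝ 2 (u n))
    (huinv : ∀ n (m : ℤ × ℤ), magTrans B0 m (u n) = u n)
    (hnorm : ∀ n, ∫ x in fund, ‖u n x‖ ^ 2 = 1)
    (hqm : (fun n => (∫ x in fund,
          ‖((h n ^ 2 : ℝ) : ℂ) * magLap α A (u n) x - u n x‖ ^ 2) ^ ((1 : ℝ) / 2))
        =o[atTop] fun n => h n ^ ((3 : ℝ) / 2)) :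
    ∀ a : Pt → ℂ, Continuous a → IsPeriodic a →
      Tendsto (fun n => ∫ x in fund, a x * ((‖u n x‖ ^ 2 : ℝ) : ℂ)) atTop
        (𝓝 (∫ x in fund, a x)) := by
  intro a ha hap
  let D : MagData :=
    .ofPotential B hBsm hBper B0 Aper hApersm hAperper A hA hcurl α
  let U : ℕ → Sec D.B0 := fun n => Sec.mk (u n) (huC2 n).continuous
    fun m x => apply_add_lat_of_magTrans (huinv n m) x
  choose e he using fun n => D.exists_error (U n) (huC2 n) (h n)
  have hU : ∀ n, ‖U n‖ = 1 := fun n => by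
    have h1 : ‖U n‖ ^ 2 = 1 := (Sec.norm_sq (U n)).trans (hnorm n)
    exact (pow_eq_one_iff_of_nonneg (norm_nonneg _) two_ne_zero).1 h1
  have hen : ∀ n, (∫ x in fund,
      ‖((h n ^ 2 : ℝ) : ℂ) * magLap α A (u n) x - u n x‖ ^ 2) ^ ((1 : ℝ) / 2) = ‖e n‖ := fun n => by
    rw [← Real.sqrt_eq_rpow, ← Real.sqrt_sq (norm_nonneg (e n)), Sec.norm_sq]
    simp only [he n]
    rfl
  have hs : ∀ n, h n ^ ((3 : ℝ) / 2) = √(h n) ^ 3 := fun n => by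
    rw [Real.sqrt_eq_rpow, ← Real.rpow_natCast, ← Real.rpow_mul (hhpos n).le]; norm_num
  have hq := hqm.tendsto_div_nhds_zero
  simp only [hen, hs] at hq
  refine tendsto_integral_mul_of_char (fun n => (huC2 n).continuous.norm.pow 2)
    (fun n x => sq_nonneg _) hnorm (fun m hm => ?_) ha hap
  refine (MagData.tendsto_inner_char (D := D) (u := U) hm (fun x => ?_) hhpos hh0 huC2 he hU hq).congr
    fun n => D.inner_char m (U n)
  have hm' : ((-m.2, m.1) : ℤ × ℤ) ≠ 0 := fun h0 => hm (by
    rw [Prod.ext_iff] at h0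
    exact Prod.ext h0.2 (neg_eq_zero.1 h0.1))
  have hK := MagData.nsq_lat_pos hm'
  have hℓ := Real.sqrt_pos.2 hK
  rw [MagData.perp_lat, MagData.lineInt_lat_eq_of_tendsto D.contDiff_B.continuous D.isPeriodic_B _ hℓ x
    (hBinf x _)]
  refine hpos x _ ?_
  simp only [Prod.smul_fst, Prod.smul_snd, smul_eq_mul, mul_pow, inv_pow, Real.sq_sqrt hK.le]
  rw [← mul_add]
  refine (congrArg _ ?_).trans (inv_mul_cancel₀ hK.ne')
  simp only [nsq, dotp]; ring
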